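/- Let X be a graph-like continuum. If a vertex v of X is even, then v has strongly even degree; and if v is odd, then v has strongly odd degree. -/

import Mathlib

open Set Topology Filter Function

universe u

/-- A compact graph-like space structure on a topological space `X`:
a closed zero-dimensional vertex set `V` together with an index type `E`
(carrying the discrete topology) such that `X \ V ≅ E × (0,1)`. -/
structure GraphLike (X : Type u) [TopologicalSpace X] where
  V : Set X
  closedV : IsClosed V
  zeroDimV : TotallyDisconnectedSpace V
  E : Type
  homeo :
    letI : TopologicalSpace E := ⊥
    Nonempty ((Vᶜ : Set X) ≃ₜ (E × ↥(Set.Ioo (0 : ℝ) 1)))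

variable {X : Type u} [TopologicalSpace X]

/-- An edge of a graph-like space: a connected component of `X \ V`. -/
def GraphLike.IsEdge (G : GraphLike X) (e : Set X) : Prop :=
  ∃ x, x ∈ (G.V)ᶜ ∧ e = connectedComponentIn (G.V)ᶜ x

/-- A subset of the vertex set which is clopen in the subspace `V`. -/
def GraphLike.ClopenIn (G : GraphLike X) (C : Set X) : Prop :=
  C ⊆ G.V ∧ IsClosed C ∧ IsClosed (G.V \ C)

/-- A separation of a graph-like space: a partition of the vertex set into
two disjoint clopen pieces. -/
structure GraphLike.Separation (G : GraphLike X) where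
  A : Set X
  B : Set X
  clopenA : G.ClopenIn A
  clopenB : G.ClopenIn B
  disjoint : A ∩ B = ∅
  union : A ∪ B = G.V

/-- The cut induced by a pair of vertex sets: all edges whose closure meets both. -/
def GraphLike.cut (G : GraphLike X) (A B : Set X) : Set (Set X) :=
  {e | G.IsEdge e ∧ (closure e ∩ A).Nonempty ∧ (closure e ∩ B).Nonempty}

/-- A cut is even if it is finite of even cardinality. -/
def GraphLike.EvenCut (G : GraphLike X) (A B : Set X) : Prop :=
  (G.cut A B).Finite ∧ Even (G.cut A B).ncard

/-- A vertex is even if it has a clopen neighbourhood `A` in `V` such that every clopen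
`C` with `v ∈ C ⊆ A` induces an even cut `E(C, V ∖ C)`. -/
def GraphLike.EvenVertex (G : GraphLike X) (v : X) : Prop :=
  ∃ A, G.ClopenIn A ∧ v ∈ A ∧
    ∀ C, G.ClopenIn C → v ∈ C → C ⊆ A →
      (G.cut C (G.V \ C)).Finite ∧ Even (G.cut C (G.V \ C)).ncard

/-- A vertex is odd if it has a clopen neighbourhood `A` in `V` such that every clopen
`C` with `v ∈ C ⊆ A` induces an odd cut `E(C, V ∖ C)`. -/
def GraphLike.OddVertex (G : GraphLike X) (v : X) : Prop :=
  ∃ A, G.ClopenIn A ∧ v ∈ A ∧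
    ∀ C, G.ClopenIn C → v ∈ C → C ⊆ A →
      (G.cut C (G.V \ C)).Finite ∧ Odd (G.cut C (G.V \ C)).ncard

/-- The set of `n` such that there exist `n` pairwise edge-disjoint arcs in `X`, each
with one endpoint in `A` and the other in `B`. -/
def GraphLike.arcConn (G : GraphLike X) (A B : Set X) : Set ℕ :=
  {n | ∃ f : Fin n → unitInterval → X,
    (∀ i, Continuous (f i) ∧ Function.Injective (f i) ∧ f i 0 ∈ A ∧ f i 1 ∈ B) ∧
    ∀ i j, i ≠ j → ∀ e, G.IsEdge e → ¬(e ⊆ Set.range (f i) ∧ e ⊆ Set.range (f j))}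

/-- A vertex `v` has strongly even degree if it has a clopen neighbourhood `C` in `V`
such that for every clopen neighbourhood `A ⊆ C` of `v`, the maximum number of pairwise
edge-disjoint arcs from `V ∖ A` to `v` is even. -/
def GraphLike.StronglyEvenDegree (G : GraphLike X) (v : X) : Prop :=
  ∃ C, G.ClopenIn C ∧ v ∈ C ∧
    ∀ A, G.ClopenIn A → v ∈ A → A ⊆ C →
      ∃ m, IsGreatest (G.arcConn {v} (G.V \ A)) m ∧ Even m

/-- A vertex `v` has strongly odd degree if it has a clopen neighbourhood `C` in `V`
such that for every clopen neighbourhood `A ⊆ C` of `v`, the maximum number of pairwise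
edge-disjoint arcs from `V ∖ A` to `v` is odd. -/
def GraphLike.StronglyOddDegree (G : GraphLike X) (v : X) : Prop :=
  ∃ C, G.ClopenIn C ∧ v ∈ C ∧
    ∀ A, G.ClopenIn A → v ∈ A → A ⊆ C →
      ∃ m, IsGreatest (G.arcConn {v} (G.V \ A)) m ∧ Odd m


/-- edge `e` crosses the vertex set `C`. -/
def crs {W E : Type*} (a b : E → W) (C : Set W) (e : E) : Prop := ¬ (a e ∈ C ↔ b e ∈ C)

section
open Classical

theorem menger_base {W E : Type*} (a b : E → W) (s t : W) (hst : s ≠ t) :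
    ∀ (k : ℕ) (F : Finset E), (∀ e ∈ F, a e = s ∨ a e = t ∨ b e = s ∨ b e = t) →
    (∀ D : Set W, s ∈ D → t ∉ D → k ≤ (F.filter (crs a b D)).card) →
    ∃ c : E → ℕ, ∀ D : Set W, s ∈ D → t ∉ D → ∀ i < k, ∃ e ∈ F, crs a b D e ∧ c e = i := by
  intro k
  induction k with
  | zero => intro F _ _; exact ⟨fun _ => 0, by intros; omega⟩
  | succ k ih =>
    intro F hF hcut
    have key : ∃ e ∈ F, ∃ f ∈ F, ∀ D : Set W, s ∈ D → t ∉ D →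
        (crs a b D e ∨ crs a b D f) ∧ (e = f ∨ ¬ (crs a b D e ∧ crs a b D f)) := by
      by_contra hno
      push Not at hno
      have h1 : ∀ e ∈ F, ¬ ((a e = s ∧ b e = t) ∨ (a e = t ∧ b e = s)) := by
        intro e he h
        obtain ⟨D, hs, ht, hD⟩ := hno e he e he
        unfold crs at hD
        have := hD (by rcases h with h | h <;> rw [h.1, h.2] <;> tauto)
        tauto
      have h2 : ∀ e ∈ F, ∀ f ∈ F, ∀ x, x ≠ s → x ≠ t →
          ((a e = s ∧ b e = x) ∨ (a e = x ∧ b e = s)) →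
          ((a f = t ∧ b f = x) ∨ (a f = x ∧ b f = t)) → False := by
        intro e he f hf x hxs hxt h h'
        obtain ⟨D, hs, ht, hD⟩ := hno e he f hf
        unfold crs at hD
        by_cases hx : x ∈ D <;>
        rcases h with h | h <;> rcases h' with h' | h' <;>
          rw [h.1, h.2, h'.1, h'.2] at hD <;> tauto
      have := hcut ({s} ∪ {x | x ≠ t ∧ ∃ e ∈ F, (a e = s ∧ b e = x) ∨ (a e = x ∧ b e = s)})
        (by simp) (by simp [hst.symm])
      have h0 : (F.filter (crs a b ({s} ∪ {x | x ≠ t ∧ ∃ e ∈ F, (a e = s ∧ b e = x) ∨ (a e = x ∧ b e = s)}))) = ∅ := by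
        rw [Finset.filter_eq_empty_iff]
        intro e he hc
        have hFe := hF e he
        have h1e := h1 e he
        have h2e := fun f hf => h2 f hf e he
        simp only [crs, mem_union, mem_singleton_iff, mem_ofPred_eq] at hc
        grind
      rw [h0] at this
      simp at this
    obtain ⟨e, he, f, hf, hef⟩ := key
    obtain ⟨c, hc⟩ := ih ((F.erase e).erase f) (by
        intro e' he'
        exact hF e' (Finset.mem_of_mem_erase (Finset.mem_of_mem_erase he'))) (by
        intro D hs ht
        have h1 := hcut D hs ht
        have h2 := hef D hs ht
        have h3 : (((F.erase e).erase f).filter (crs a b D)) = ((F.filter (crs a b D)).erase e).erase f := by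
          ext x; simp only [Finset.mem_filter, Finset.mem_erase]; tauto
        rw [h3]
        by_cases hce : crs a b D e
        · have : ((F.filter (crs a b D)).erase e).erase f = (F.filter (crs a b D)).erase e := by
            apply Finset.erase_eq_of_notMem
            simp only [Finset.mem_erase, Finset.mem_filter]
            grind
          rw [this]
          have := Finset.pred_card_le_card_erase (s := F.filter (crs a b D)) (a := e)
          omega
        · have : ((F.filter (crs a b D)).erase e) = (F.filter (crs a b D)) := by
            apply Finset.erase_eq_of_notMem
            simp only [Finset.mem_filter]
            grind
          rw [this]
          have := Finset.pred_card_le_card_erase (s := F.filter (crs a b D)) (a := f)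
          omega)
    refine ⟨fun x => if x = e ∨ x = f then k else c x, ?_⟩
    intro D hs ht i hi
    by_cases hik : i = k
    · rcases (hef D hs ht).1 with h | h
      · exact ⟨e, he, h, by simp [hik]⟩
      · exact ⟨f, hf, h, by simp [hik]⟩
    · obtain ⟨x, hx, hxc, hxi⟩ := hc D hs ht i (by omega)
      refine ⟨x, Finset.mem_of_mem_erase (Finset.mem_of_mem_erase hx), hxc, ?_⟩
      simp only [Finset.mem_erase] at hx
      simp [hx.1, hx.2.1, hxi]

theorem menger_fin {W E : Type*} (s t : W) (hst : s ≠ t) (k : ℕ) :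
    ∀ (n : ℕ) (F : Finset E) (a b : E → W),
    (F.filter (fun e => a e ≠ s ∧ a e ≠ t ∧ b e ≠ s ∧ b e ≠ t)).card ≤ n →
    (∀ D : Set W, s ∈ D → t ∉ D → k ≤ (F.filter (crs a b D)).card) →
    ∃ c : E → ℕ, ∀ D : Set W, s ∈ D → t ∉ D → ∀ i < k, ∃ e ∈ F, crs a b D e ∧ c e = i := by
  intro n
  induction n with
  | zero =>
    intro F a b hn hcut
    apply menger_base a b s t hst k F _ hcut
    intro e he
    have := Finset.card_eq_zero.1 (Nat.le_zero.1 hn)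
    rw [Finset.filter_eq_empty_iff] at this
    have := this he
    tauto
  | succ n ih =>
    intro F a b hn hcut
    by_cases hall : ∀ e ∈ F, a e = s ∨ a e = t ∨ b e = s ∨ b e = t
    · exact menger_base a b s t hst k F hall hcut
    push Not at hall
    obtain ⟨e, he, hes⟩ := hall
    have hlt : ∀ G : Finset E, G ⊆ F.filter (fun e => a e ≠ s ∧ a e ≠ t ∧ b e ≠ s ∧ b e ≠ t) →
        e ∉ G → G.card ≤ n := by
      intro G hG heG
      have : G.card < (F.filter (fun e => a e ≠ s ∧ a e ≠ t ∧ b e ≠ s ∧ b e ≠ t)).card := by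
        apply Finset.card_lt_card
        refine ⟨hG, fun h => heG (h ?_)⟩
        simp only [Finset.mem_filter]; exact ⟨he, hes⟩
      omega
    by_cases htight : ∃ D0 : Set W, s ∈ D0 ∧ t ∉ D0 ∧ crs a b D0 e ∧ (F.filter (crs a b D0)).card = k
    swap
    · push Not at htight
      obtain ⟨c, hc⟩ := ih (F.erase e) a b (by
          apply hlt
          · intro x; simp only [Finset.mem_filter, Finset.mem_erase]; tauto
          · simp) (by
          intro D hs ht
          have h1 := hcut D hs ht
          rw [Finset.filter_erase]
          by_cases hce : crs a b D e
          · have h2 := htight D hs ht hce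
            have := Finset.pred_card_le_card_erase (s := F.filter (crs a b D)) (a := e)
            omega
          · rw [Finset.erase_eq_of_notMem]
            · exact h1
            · simp [hce])
      refine ⟨c, fun D hs ht i hi => ?_⟩
      obtain ⟨x, hx, h⟩ := hc D hs ht i hi
      exact ⟨x, Finset.mem_of_mem_erase hx, h⟩
    obtain ⟨D0, hs0, ht0, hce, hcard⟩ := htight
    obtain ⟨c1, hc1⟩ := ih F (fun x => if a x ∈ D0 then a x else t) (fun x => if b x ∈ D0 then b x else t)
      (by
        apply hlt
        · intro x; simp only [Finset.mem_filter]; grind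
        · simp only [Finset.mem_filter, crs] at hce ⊢; grind)
      (by
        intro D hs ht
        convert hcut (D ∩ D0) ⟨hs, hs0⟩ (fun h => ht h.1) using 3
        rename_i x
        simp only [crs, mem_inter_iff]
        grind)
    obtain ⟨c2, hc2⟩ := ih F (fun x => if a x ∈ D0 then s else a x) (fun x => if b x ∈ D0 then s else b x)
      (by
        apply hlt
        · intro x; simp only [Finset.mem_filter]; grind
        · simp only [Finset.mem_filter, crs] at hce ⊢; grind)
      (by
        intro D hs ht
        convert hcut (D ∪ D0) (Or.inl hs) (by simp [ht, ht0]) using 3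
        rename_i x
        simp only [crs, mem_union]
        grind)
    replace hc1 : ∀ D : Set W, s ∈ D → t ∉ D → ∀ i < k, ∃ e ∈ F, crs a b (D ∩ D0) e ∧ c1 e = i := by
      intro D hs ht i hi
      obtain ⟨x, hx, h, h'⟩ := hc1 D hs ht i hi
      refine ⟨x, hx, ?_, h'⟩
      simp only [crs, mem_inter_iff] at h ⊢
      grind
    replace hc2 : ∀ D : Set W, s ∈ D → t ∉ D → ∀ i < k, ∃ e ∈ F, crs a b (D ∪ D0) e ∧ c2 e = i := by
      intro D hs ht i hi
      obtain ⟨x, hx, h, h'⟩ := hc2 D hs ht i hi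
      refine ⟨x, hx, ?_, h'⟩
      simp only [crs, mem_union] at h ⊢
      grind
    set T := F.filter (crs a b D0) with hT
    have bij : ∀ c : E → ℕ, (∀ i < k, ∃ e ∈ F, crs a b D0 e ∧ c e = i) →
        T.image c = Finset.range k ∧ Set.InjOn c T := by
      intro c hc
      have h1 : Finset.range k ⊆ T.image c := by
        intro i hi
        obtain ⟨x, hx, h, h'⟩ := hc i (Finset.mem_range.1 hi)
        exact Finset.mem_image.2 ⟨x, Finset.mem_filter.2 ⟨hx, h⟩, h'⟩
      have h2 : (T.image c).card ≤ k := hcard ▸ Finset.card_image_le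
      have h3 : Finset.range k = T.image c := Finset.eq_of_subset_of_card_le h1 (by simpa using h2)
      refine ⟨h3.symm, Finset.card_image_iff.1 ?_⟩
      rw [← h3, hcard]; simp
    obtain ⟨im1, inj1⟩ := bij c1 (by simpa using hc1 D0 hs0 ht0)
    obtain ⟨im2, inj2⟩ := bij c2 (by simpa using hc2 D0 hs0 ht0)
    let π : ℕ → ℕ := fun j => if h : ∃ x ∈ T, c2 x = j then c1 h.choose else 0
    have hπ : ∀ x ∈ T, π (c2 x) = c1 x := by
      intro x hx
      have h : ∃ y ∈ T, c2 y = c2 x := ⟨x, hx, rfl⟩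
      simp only [π, dif_pos h]
      rw [inj2 h.choose_spec.1 hx h.choose_spec.2]
    refine ⟨fun x => if a x ∈ D0 ∨ b x ∈ D0 then c1 x else π (c2 x), ?_⟩
    intro D hs ht i hi
    obtain ⟨ei, heiT, hei⟩ := Finset.mem_image.1 (im1 ▸ Finset.mem_range.2 hi)
    have hj : c2 ei < k := Finset.mem_range.1 (im2 ▸ Finset.mem_image_of_mem c2 heiT)
    obtain ⟨e1, h1F, h1c, h1i⟩ := hc1 D hs ht i hi
    obtain ⟨e2, h2F, h2c, h2i⟩ := hc2 D hs ht _ hj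
    by_cases h1T : e1 ∈ T
    · by_cases h2T : e2 ∈ T
      · have e1e : e1 = ei := inj1 h1T heiT (by rw [h1i, hei])
        have e2e : e2 = ei := inj2 h2T heiT h2i
        subst e1e; subst e2e
        refine ⟨e2, h1F, ?_, ?_⟩
        · have := (Finset.mem_filter.1 heiT).2
          simp only [crs, mem_union, mem_inter_iff] at this h1c h2c ⊢
          clear * - this h1c h2c
          tauto
        · have := (Finset.mem_filter.1 heiT).2
          simp only [crs] at this
          simp only [hei]
          grind
      · refine ⟨e2, h2F, ?_, ?_⟩
        · simp only [hT, Finset.mem_filter, h2F, true_and] at h2T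
          simp only [crs, mem_union, mem_inter_iff] at h2T h2c ⊢
          clear * - h2T h2c
          tauto
        · have : ¬ (a e2 ∈ D0 ∨ b e2 ∈ D0) := by
            simp only [hT, Finset.mem_filter, h2F, true_and] at h2T
            simp only [crs, mem_union, mem_inter_iff] at h2T h2c ⊢
            clear * - h2T h2c
            tauto
          simp only [if_neg this, h2i, hπ _ heiT, hei]
    · have hh : a e1 ∈ D0 ∧ b e1 ∈ D0 ∧ crs a b D e1 := by
        simp only [hT, Finset.mem_filter, h1F, true_and] at h1T
        simp only [crs, mem_union, mem_inter_iff] at h1T h1c ⊢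
        clear * - h1T h1c
        tauto
      refine ⟨e1, h1F, hh.2.2, ?_⟩
      simp only [if_pos (Or.inl hh.1), h1i]

end

section
open Classical

theorem coloring {W E : Type*} [TopologicalSpace W] (a b : E → W)
    (hfin : ∀ C : Set W, IsClopen C → {e | crs a b C e}.Finite) (v : W) (A : Set W) (k : ℕ)
    (hk : ∀ C : Set W, IsClopen C → v ∈ C → C ⊆ A → k ≤ {e | crs a b C e}.ncard) :
    ∃ c : E → ℕ, ∀ C : Set W, IsClopen C → v ∈ C → C ⊆ A → ∀ i < k, ∃ e, crs a b C e ∧ c e = i := by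
  rcases Nat.eq_zero_or_pos k with rfl | hk0
  · exact ⟨fun _ => 0, by intros; omega⟩
  let ι := {C : Set W // IsClopen C ∧ v ∈ C ∧ C ⊆ A}
  let Z : ι → Set (E → Fin k) := fun C => {c | ∀ i : Fin k, ∃ e, crs a b C.1 e ∧ c e = i}
  have hZ : ∀ C, IsClosed (Z C) := by
    intro C
    have : Z C = ⋂ i : Fin k, ⋃ e ∈ {e | crs a b C.1 e}, {c : E → Fin k | c e = i} := by
      ext c; simp [Z]
    rw [this]
    refine isClosed_iInter fun i => (hfin _ C.2.1).isClosed_biUnion fun e _ => ?_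
    exact isClosed_eq (continuous_apply e) continuous_const
  have hne : (univ ∩ ⋂ C, Z C).Nonempty := by
    refine isCompact_univ.inter_iInter_nonempty Z hZ ?_
    intro u
    rw [univ_inter]
    rcases u.eq_empty_or_nonempty with rfl | ⟨C0, hC0⟩
    · exact ⟨fun _ => ⟨0, hk0⟩, by simp⟩
    let pat : W → Set ι := fun x => {C | C ∈ u ∧ x ∈ C.1}
    have hpat : IsLocallyConstant pat := by
      rw [IsLocallyConstant.iff_eventually_eq]
      intro x
      have : ∀ᶠ y in 𝓝 x, ∀ C ∈ u, (y ∈ C.1 ↔ x ∈ C.1) := by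
        rw [Finset.eventually_all]
        intro C _
        by_cases hx : x ∈ C.1
        · filter_upwards [C.2.1.isOpen.mem_nhds hx] with y hy
          simp [hx, hy]
        · filter_upwards [C.2.1.compl.isOpen.mem_nhds hx] with y hy
          exact ⟨fun h => absurd h hy, fun h => absurd h hx⟩
      filter_upwards [this] with y hy
      ext C
      simp only [pat, mem_ofPred_eq]
      exact and_congr_right (hy C)
    let F : Finset E := u.biUnion fun C => (hfin C.1 C.2.1).toFinset
    have hs : pat v = {C | C ∈ u} := by
      ext C; simp only [pat, mem_ofPred_eq]; exact ⟨fun h => h.1, fun h => ⟨h, C.2.2.1⟩⟩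
    obtain ⟨c, hc⟩ := menger_fin (pat v) (∅ : Set ι) (by
        intro h
        have : C0 ∈ (∅ : Set ι) := h ▸ (hs ▸ hC0 : C0 ∈ pat v)
        exact this) k _ F (fun e => pat (a e)) (fun e => pat (b e)) le_rfl (by
        intro D hvD htD
        have hcl : IsClopen (pat ⁻¹' D) := ⟨⟨by rw [← preimage_compl]; exact hpat _⟩, hpat D⟩
        have h1 := hk (pat ⁻¹' D) hcl hvD (by
          intro x hx
          by_contra hxA
          apply htD
          have : pat x = ∅ := by
            ext C
            simp only [pat, mem_ofPred_eq, mem_empty_iff_false, iff_false]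
            exact fun h => hxA (C.2.2.2 h.2)
          exact this ▸ hx)
        have h2 : {e | crs a b (pat ⁻¹' D) e} = ((F.filter (crs (fun e => pat (a e)) (fun e => pat (b e)) D) : Finset E) : Set E) := by
          ext e
          simp only [mem_ofPred_eq, Finset.coe_filter]
          constructor
          · intro h
            refine ⟨?_, h⟩
            by_contra hF
            apply h
            have : pat (a e) = pat (b e) := by
              ext C
              simp only [pat, mem_ofPred_eq]
              refine and_congr_right fun hC => ?_
              by_contra hcr
              exact hF (Finset.mem_biUnion.2 ⟨C, hC, by simpa [crs] using hcr⟩)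
            simp only [mem_preimage, this]
          · exact fun h => h.2
        rw [h2, Set.ncard_coe_finset] at h1
        exact h1)
    refine ⟨fun e => if h : c e < k then ⟨c e, h⟩ else ⟨0, hk0⟩, ?_⟩
    simp only [mem_iInter]
    intro C hC i
    obtain ⟨e, _, hcr, hce⟩ := hc {p | C ∈ p} (by simp [hs, hC]) (by simp) i i.2
    refine ⟨e, ?_, ?_⟩
    · simp only [crs, mem_ofPred_eq, pat, hC, true_and] at hcr
      exact hcr
    · simp [hce]
  obtain ⟨c, -, hc⟩ := hne
  refine ⟨fun e => c e, fun C h1 h2 h3 i hi => ?_⟩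
  obtain ⟨e, he, hce⟩ := mem_iInter.1 hc ⟨C, h1, h2, h3⟩ ⟨i, hi⟩
  exact ⟨e, he, by simp [hce]⟩

theorem target {W E : Type*} [TopologicalSpace W] [CompactSpace W] (a b : E → W)
    (v : W) (A : Set W) (hA : IsClopen A) (P : Set E)
    (hP : ∀ C : Set W, IsClopen C → v ∈ C → C ⊆ A → ∃ e ∈ P, crs a b C e) :
    ∃ w, w ∉ A ∧ ∀ C : Set W, IsClopen C → v ∈ C → w ∉ C → ∃ e ∈ P, crs a b C e := by
  by_contra hno
  push Not at hno
  choose! C hC hv hw hn using hno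
  have hcomp : IsCompact Aᶜ := hA.compl.isClosed.isCompact
  obtain ⟨t, ht, hcov⟩ := hcomp.elim_nhds_subcover (fun w => (C w)ᶜ)
    (fun w hw' => (hC w hw').compl.isOpen.mem_nhds (hw w hw'))
  obtain ⟨e, he, hcr⟩ := hP (⋂ w ∈ t, C w) (isClopen_biInter_finset fun w hw' => hC w (ht w hw'))
    (mem_iInter₂.2 fun w hw' => hv w (ht w hw')) (by
      intro x hx
      by_contra hxA
      obtain ⟨w, hwt, hxw⟩ := mem_iUnion₂.1 (hcov hxA)
      exact hxw (mem_iInter₂.1 hx w hwt))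
  apply hcr
  simp only [mem_iInter]
  refine forall₂_congr fun w hwt => ?_
  have := hn w (ht w hwt) e he
  simpa [crs] using this

/-- `C` is a separation of `v` from `w` crossed by no edge of `P` other than `e`. -/
def tight {W E : Type*} [TopologicalSpace W] (a b : E → W) (P : Set E) (v w : W) (e : E) (C : Set W) : Prop :=
  IsClopen C ∧ v ∈ C ∧ w ∉ C ∧ ∀ f ∈ P, crs a b C f → f = e

theorem exists_minimal {W E : Type*} [TopologicalSpace W] (a b : E → W)
    (hfin : ∀ C : Set W, IsClopen C → {e | crs a b C e}.Finite) (v w : W) (P : Set E)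
    (hP : ∀ C : Set W, IsClopen C → v ∈ C → w ∉ C → ∃ e ∈ P, crs a b C e) :
    ∃ Q ⊆ P, (∀ C : Set W, IsClopen C → v ∈ C → w ∉ C → ∃ e ∈ Q, crs a b C e) ∧
      ∀ e ∈ Q, ∃ C, tight a b Q v w e C := by
  obtain ⟨Q, hQP, hQ⟩ := zorn_superset_nonempty
    {Q : Set E | ∀ C : Set W, IsClopen C → v ∈ C → w ∉ C → ∃ e ∈ Q, crs a b C e} (by
      intro c hc hchain hne
      refine ⟨⋂₀ c, ?_, fun s hs => sInter_subset_of_mem hs⟩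
      intro C hC hv hw
      by_contra hno
      push Not at hno
      have : ∀ e ∈ {e | crs a b C e}, ∃ Q ∈ c, e ∉ Q := by
        intro e he
        by_contra h
        push Not at h
        exact hno e (mem_sInter.2 h) he
      choose! q hq hq' using this
      obtain ⟨Q0, hQ0⟩ := hne
      -- smallest of finitely many
      have key : ∀ s : Finset E, (∀ e ∈ s, crs a b C e) → ∃ Q ∈ c, ∀ e ∈ s, e ∉ Q := by
        intro s
        induction s using Finset.induction_on with
        | empty => exact fun _ => ⟨Q0, hQ0, by simp⟩
        | insert x s hx ih =>
          intro hs
          obtain ⟨Q, hQ, hQs⟩ := ih fun e he => hs e (Finset.mem_insert_of_mem he)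
          have hxc := hs x (Finset.mem_insert_self _ _)
          rcases hchain.total hQ (hq x hxc) with h | h
          · refine ⟨Q, hQ, fun e he => ?_⟩
            rcases Finset.mem_insert.1 he with rfl | he
            · exact fun h' => hq' _ hxc (h h')
            · exact hQs e he
          · refine ⟨q x, hq x hxc, fun e he => ?_⟩
            rcases Finset.mem_insert.1 he with rfl | he
            · exact hq' _ hxc
            · exact fun h' => hQs e he (h h')
      obtain ⟨Q, hQ, hQn⟩ := key (hfin C hC).toFinset (by simp)
      obtain ⟨e, he, hcr⟩ := hc hQ C hC hv hw
      exact hQn e (by simpa using hcr) he) P hP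
  refine ⟨Q, hQP, hQ.prop, ?_⟩
  intro e he
  by_contra hno
  push Not at hno
  have : Q ⊆ Q \ {e} := by
    apply hQ.2 _ sdiff_subset
    intro C hC hv hw
    by_contra h
    push Not at h
    refine hno C ⟨hC, hv, hw, fun f hf hcr => ?_⟩
    by_contra hfe
    exact h f ⟨hf, hfe⟩ hcr
  exact (this he).2 rfl

structure Lin {W E : Type*} [TopologicalSpace W] (a b : E → W) (P : Set E) (v w : W) (K : E → Set W) : Prop where
  hit : ∀ C : Set W, IsClopen C → v ∈ C → w ∉ C → ∃ e ∈ P, crs a b C e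
  tK : ∀ e ∈ P, tight a b P v w e (K e)
  aK : ∀ e ∈ P, a e ∈ K e
  bK : ∀ e ∈ P, b e ∉ K e

/-- vertices lying on the arc -/
def good {W E : Type*} [TopologicalSpace W] (a b : E → W) (P : Set E) (v w : W) (K : E → Set W) (x : W) : Prop :=
  ∀ e ∈ P, ∀ C, tight a b P v w e C → (x ∈ C ↔ x ∈ K e)

section lin
variable {W E : Type*} [TopologicalSpace W] {a b : E → W} {P : Set E} {v w : W} {K : E → Set W}

theorem Lin.good_v (L : Lin a b P v w K) : good a b P v w K v :=
  fun e he _ hC => ⟨fun _ => (L.tK e he).2.1, fun _ => hC.2.1⟩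

theorem Lin.good_w (L : Lin a b P v w K) : good a b P v w K w :=
  fun e he _ hC => ⟨fun h => absurd h hC.2.2.1, fun h => absurd h (L.tK e he).2.2.1⟩

theorem Lin.inter_crs (L : Lin a b P v w K) {C D : Set W} {e f : E}
    (hC : tight a b P v w e C) (hD : tight a b P v w f D) :
    ∃ g ∈ P, (g = e ∨ g = f) ∧ crs a b (C ∩ D) g := by
  obtain ⟨g, hg, hc⟩ := L.hit (C ∩ D) (hC.1.inter hD.1) ⟨hC.2.1, hD.2.1⟩ (fun h => hC.2.2.1 h.1)
  refine ⟨g, hg, ?_, hc⟩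
  by_contra hno
  push Not at hno
  have h1 := mt (hC.2.2.2 g hg) hno.1
  have h2 := mt (hD.2.2.2 g hg) hno.2
  simp only [crs, mem_inter_iff] at *
  tauto

theorem Lin.union_crs (L : Lin a b P v w K) {C D : Set W} {e f : E}
    (hC : tight a b P v w e C) (hD : tight a b P v w f D) :
    ∃ g ∈ P, (g = e ∨ g = f) ∧ crs a b (C ∪ D) g := by
  obtain ⟨g, hg, hc⟩ := L.hit (C ∪ D) (hC.1.union hD.1) (Or.inl hC.2.1) (by simp [hC.2.2.1, hD.2.2.1])
  refine ⟨g, hg, ?_, hc⟩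
  by_contra hno
  push Not at hno
  have h1 := mt (hC.2.2.2 g hg) hno.1
  have h2 := mt (hD.2.2.2 g hg) hno.2
  simp only [crs, mem_union] at *
  tauto

theorem Lin.ends (L : Lin a b P v w K) {e : E} (he : e ∈ P) {C : Set W}
    (hC : tight a b P v w e C) : a e ∈ C ∧ b e ∉ C := by
  have ha := L.aK e he
  have hb := L.bK e he
  constructor
  · obtain ⟨g, hg, h, hc⟩ := L.inter_crs hC (L.tK e he)
    have : g = e := by tauto
    subst this
    simp only [crs, mem_inter_iff] at hc
    tauto
  · obtain ⟨g, hg, h, hc⟩ := L.union_crs hC (L.tK e he)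
    have : g = e := by tauto
    subst this
    simp only [crs, mem_union] at hc
    tauto

theorem Lin.good_aux (L : Lin a b P v w K) {e f : E} (he : e ∈ P) (hf : f ∈ P) (hef : e ≠ f)
    {C C' : Set W} (hC : tight a b P v w f C) (hC' : tight a b P v w f C')
    (h : a e ∈ C) (h' : a e ∉ C') : False := by
  have hCe := mt (hC.2.2.2 e he) hef
  have hCe' := mt (hC'.2.2.2 e he) hef
  have hKf := mt ((L.tK e he).2.2.2 f hf) hef.symm
  simp only [crs, not_not] at hCe hCe' hKf
  by_cases hfe : a f ∈ K e
  · obtain ⟨g, hg, h1, hc⟩ := L.union_crs hC (L.tK e he)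
    simp only [crs, mem_union] at hc
    rcases h1 with rfl | rfl <;> tauto
  · obtain ⟨g, hg, h1, hc⟩ := L.inter_crs hC' (L.tK e he)
    simp only [crs, mem_inter_iff] at hc
    rcases h1 with rfl | rfl <;> tauto

theorem Lin.good_a (L : Lin a b P v w K) {e : E} (he : e ∈ P) : good a b P v w K (a e) := by
  intro f hf C hC
  by_cases hef : e = f
  · subst hef
    exact ⟨fun _ => L.aK e he, fun _ => (L.ends he hC).1⟩
  · constructor
    · intro h; by_contra h'; exact L.good_aux he hf hef hC (L.tK f hf) h h'
    · intro h; by_contra h'; exact L.good_aux he hf hef (L.tK f hf) hC h h'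

theorem Lin.good_b (L : Lin a b P v w K) {e : E} (he : e ∈ P) : good a b P v w K (b e) := by
  intro f hf C hC
  by_cases hef : e = f
  · subst hef
    have := L.bK e he
    have := (L.ends he hC).2
    tauto
  · have h1 := mt (hC.2.2.2 e he) hef
    have h2 := mt ((L.tK f hf).2.2.2 e he) hef
    have := L.good_a he f hf C hC
    simp only [crs, not_not] at h1 h2
    tauto

theorem Lin.le_a (L : Lin a b P v w K) {e f : E} (he : e ∈ P) (hf : f ∈ P) {z : W}
    (hz : good a b P v w K z) (h : z ∈ K e) (hzf : z ∉ K f) : a e ∉ K f := by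
  intro haf
  have hef : e ≠ f := by rintro rfl; exact hzf h
  have h1 := mt ((L.tK f hf).2.2.2 e he) hef
  have t1 := L.tK e he
  have t2 := L.tK f hf
  have : tight a b P v w f (K e ∪ K f) := by
    refine ⟨t1.1.union t2.1, Or.inl t1.2.1, by simp [t1.2.2.1, t2.2.2.1], ?_⟩
    intro g hg hc
    by_contra hgf
    have h2 := mt (t1.2.2.2 g hg)
    have h3 := mt (t2.2.2.2 g hg) hgf
    by_cases hge : g = e
    · subst hge
      simp only [crs, mem_union] at *; tauto
    · have := h2 hge
      simp only [crs, mem_union] at *; tauto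
  exact hzf ((hz f hf _ this).1 (Or.inl h))

theorem Lin.b_le (L : Lin a b P v w K) {e f : E} (he : e ∈ P) (hf : f ∈ P) {z : W}
    (hz : good a b P v w K z) (h : z ∉ K e) (hbf : b e ∉ K f) : z ∉ K f := by
  intro hzf
  have hef : e ≠ f := by rintro rfl; exact h hzf
  have h1 := mt ((L.tK f hf).2.2.2 e he) hef
  have t1 := L.tK e he
  have t2 := L.tK f hf
  have : tight a b P v w f (K e ∩ K f) := by
    refine ⟨t1.1.inter t2.1, ⟨t1.2.1, t2.2.1⟩, fun h => t1.2.2.1 h.1, ?_⟩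
    intro g hg hc
    by_contra hgf
    have h2 := mt (t1.2.2.2 g hg)
    have h3 := mt (t2.2.2.2 g hg) hgf
    by_cases hge : g = e
    · subst hge
      simp only [crs, mem_inter_iff] at *; tauto
    · have := h2 hge
      simp only [crs, mem_inter_iff] at *; tauto
  exact h ((hz f hf _ this).2 hzf).1

theorem Lin.tight_union (L : Lin a b P v w K) {C D : Set W} {e f : E} (he : e ∈ P) (hf : f ∈ P)
    (hC : tight a b P v w e C) (hD : tight a b P v w f D) :
    tight a b P v w e (C ∪ D) ∨ tight a b P v w f (C ∪ D) := by
  by_contra hno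
  have hb : ∀ g ∈ P, g ≠ e → g ≠ f → ¬ crs a b (C ∪ D) g := by
    intro g hg h1 h2
    have h1 := mt (hC.2.2.2 g hg) h1
    have h2 := mt (hD.2.2.2 g hg) h2
    simp only [crs, mem_union] at h1 h2 ⊢
    clear * - h1 h2
    tauto
  have hcl := hC.1.union hD.1
  have hv : v ∈ C ∪ D := Or.inl hC.2.1
  have hw : w ∉ C ∪ D := by simp [hC.2.2.1, hD.2.2.1]
  have hne : e ≠ f := by
    rintro rfl
    exact hno (Or.inl ⟨hcl, hv, hw, fun g hg hc => by_contra fun h => hb g hg h h hc⟩)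
  have hf' : crs a b (C ∪ D) f := by
    by_contra h
    exact hno (Or.inl ⟨hcl, hv, hw, fun g hg hc => by
      by_contra h'
      exact hb g hg h' (by rintro rfl; exact h hc) hc⟩)
  have he' : crs a b (C ∪ D) e := by
    by_contra h
    exact hno (Or.inr ⟨hcl, hv, hw, fun g hg hc => by
      by_contra h'
      exact hb g hg (by rintro rfl; exact h hc) h' hc⟩)
  obtain ⟨g, hg, h1, hc⟩ := L.inter_crs hC hD
  have e1 := L.ends he hC
  have e2 := L.ends hf hD
  have h2 := mt (hC.2.2.2 f hf) hne.symm
  have h3 := mt (hD.2.2.2 e he) hne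
  simp only [crs, mem_union, mem_inter_iff] at he' hf' hc h2 h3
  clear * - h1 hc e1 e2 h2 h3 he' hf'
  rcases h1 with rfl | rfl
  · clear hf' e2 h2
    tauto
  · clear he' e1 h3
    tauto

theorem Lin.tight_inter (L : Lin a b P v w K) {C D : Set W} {e f : E} (he : e ∈ P) (hf : f ∈ P)
    (hC : tight a b P v w e C) (hD : tight a b P v w f D) :
    tight a b P v w e (C ∩ D) ∨ tight a b P v w f (C ∩ D) := by
  by_contra hno
  have hb : ∀ g ∈ P, g ≠ e → g ≠ f → ¬ crs a b (C ∩ D) g := by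
    intro g hg h1 h2
    have h1 := mt (hC.2.2.2 g hg) h1
    have h2 := mt (hD.2.2.2 g hg) h2
    simp only [crs, mem_inter_iff] at h1 h2 ⊢
    clear * - h1 h2
    tauto
  have hcl := hC.1.inter hD.1
  have hv : v ∈ C ∩ D := ⟨hC.2.1, hD.2.1⟩
  have hw : w ∉ C ∩ D := fun h => hC.2.2.1 h.1
  have hne : e ≠ f := by
    rintro rfl
    exact hno (Or.inl ⟨hcl, hv, hw, fun g hg hc => by_contra fun h => hb g hg h h hc⟩)
  have hf' : crs a b (C ∩ D) f := by
    by_contra h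
    exact hno (Or.inl ⟨hcl, hv, hw, fun g hg hc => by
      by_contra h'
      exact hb g hg h' (by rintro rfl; exact h hc) hc⟩)
  have he' : crs a b (C ∩ D) e := by
    by_contra h
    exact hno (Or.inr ⟨hcl, hv, hw, fun g hg hc => by
      by_contra h'
      exact hb g hg (by rintro rfl; exact h hc) h' hc⟩)
  obtain ⟨g, hg, h1, hc⟩ := L.union_crs hC hD
  have e1 := L.ends he hC
  have e2 := L.ends hf hD
  have h2 := mt (hC.2.2.2 f hf) hne.symm
  have h3 := mt (hD.2.2.2 e he) hne
  simp only [crs, mem_union, mem_inter_iff] at he' hf' hc h2 h3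
  clear * - h1 hc e1 e2 h2 h3 he' hf'
  rcases h1 with rfl | rfl
  · clear hf' e2 h2
    tauto
  · clear he' e1 h3
    tauto

theorem Lin.exL (L : Lin a b P v w K) {x : W} (S : Finset E) :
    (∀ f ∈ S, f ∈ P ∧ x ∉ K f) → S.Nonempty → 
      ∃ e ∈ P, ∃ C, tight a b P v w e C ∧ x ∉ K e ∧ ∀ f ∈ S, K f ⊆ C := by
  induction S using Finset.induction_on with
  | empty => simp
  | insert y S hy ih =>
    intro hS _
    have hyP := hS y (Finset.mem_insert_self _ _)
    rcases S.eq_empty_or_nonempty with rfl | hne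
    · exact ⟨y, hyP.1, K y, L.tK y hyP.1, hyP.2, by simp⟩
    · obtain ⟨e, he, C, hC, hxe, hsub⟩ := ih (fun f hf => hS f (Finset.mem_insert_of_mem hf)) hne
      have hs : ∀ f ∈ insert y S, K f ⊆ C ∪ K y := by
        intro f hf
        rcases Finset.mem_insert.1 hf with rfl | hf
        · exact subset_union_right
        · exact (hsub f hf).trans subset_union_left
      rcases L.tight_union he hyP.1 hC (L.tK y hyP.1) with h | h
      · exact ⟨e, he, _, h, hxe, hs⟩
      · exact ⟨y, hyP.1, _, h, hyP.2, hs⟩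

theorem Lin.exU (L : Lin a b P v w K) {x : W} (S : Finset E) :
    (∀ f ∈ S, f ∈ P ∧ x ∈ K f) → S.Nonempty → 
      ∃ e ∈ P, ∃ C, tight a b P v w e C ∧ x ∈ K e ∧ ∀ f ∈ S, C ⊆ K f := by
  induction S using Finset.induction_on with
  | empty => simp
  | insert y S hy ih =>
    intro hS _
    have hyP := hS y (Finset.mem_insert_self _ _)
    rcases S.eq_empty_or_nonempty with rfl | hne
    · exact ⟨y, hyP.1, K y, L.tK y hyP.1, hyP.2, by simp⟩
    · obtain ⟨e, he, C, hC, hxe, hsub⟩ := ih (fun f hf => hS f (Finset.mem_insert_of_mem hf)) hne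
      have hs : ∀ f ∈ insert y S, C ∩ K y ⊆ K f := by
        intro f hf
        rcases Finset.mem_insert.1 hf with rfl | hf
        · exact inter_subset_right
        · exact inter_subset_left.trans (hsub f hf)
      rcases L.tight_inter he hyP.1 hC (L.tK y hyP.1) with h | h
      · exact ⟨e, he, _, h, hxe, hs⟩
      · exact ⟨y, hyP.1, _, h, hyP.2, hs⟩

/-- Core of injectivity. -/
theorem Lin.no_sep (L : Lin a b P v w K)
    (hfin : ∀ C : Set W, IsClopen C → {e | crs a b C e}.Finite) (hvw : v ≠ w)
    [TotallySeparatedSpace W]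
    {x y : W} (hx : good a b P v w K x) (hy : good a b P v w K y)
    (hxy : ∀ e ∈ P, (x ∈ K e ↔ y ∈ K e)) {C : Set W} (hC : IsClopen C) (hxC : x ∈ C) (hyC : y ∉ C) :
    False := by
  obtain ⟨e0, he0⟩ : P.Nonempty := by
    obtain ⟨U, hU, h1, h2⟩ := exists_isClopen_of_totally_separated hvw
    obtain ⟨e, he, _⟩ := L.hit U hU h1 h2
    exact ⟨e, he⟩
  let F : Finset E := insert e0 ((hfin C hC).toFinset.filter (· ∈ P))
  have hFP : ∀ f ∈ F, f ∈ P := by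
    intro f hf
    rcases Finset.mem_insert.1 hf with rfl | hf
    · exact he0
    · exact (Finset.mem_filter.1 hf).2
  have hFC : ∀ f ∈ P, crs a b C f → f ∈ F := fun f hf hc =>
    Finset.mem_insert_of_mem (Finset.mem_filter.2 ⟨by simpa using hc, hf⟩)
  let S1 := F.filter (fun f => x ∉ K f)
  let S2 := F.filter (fun f => x ∈ K f)
  have hS1 : ∀ f ∈ S1, f ∈ P ∧ x ∉ K f := fun f hf =>
    ⟨hFP f (Finset.mem_filter.1 hf).1, (Finset.mem_filter.1 hf).2⟩
  have hS2 : ∀ f ∈ S2, f ∈ P ∧ x ∈ K f := fun f hf =>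
    ⟨hFP f (Finset.mem_filter.1 hf).1, (Finset.mem_filter.1 hf).2⟩
  have hS : ∀ f ∈ F, f ∈ S1 ∨ f ∈ S2 := by
    intro f hf
    by_cases h : x ∈ K f
    · exact Or.inr (Finset.mem_filter.2 ⟨hf, h⟩)
    · exact Or.inl (Finset.mem_filter.2 ⟨hf, h⟩)
  -- crossing analysis
  have cross : ∀ (A B : Set W), (∀ f ∈ S1, K f ⊆ A) → (∀ f ∈ S2, B ⊆ K f) →
      ∀ C' : Set W, (C' = C ∨ C' = Cᶜ) → ∀ f ∈ P, crs a b (A ∪ (B ∩ C')) f →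
        crs a b A f ∨ crs a b B f := by
    intro A B hA hB C' hC' f hf hc
    by_contra hno
    push Not at hno
    have hcC : crs a b C f := by
      rcases hC' with rfl | rfl <;> simp only [crs, mem_union, mem_inter_iff, mem_compl_iff] at * <;> tauto
    rcases hS f (hFC f hf hcC) with h | h
    · have h1 := hA f h (L.aK f hf)
      simp only [crs, mem_union, mem_inter_iff] at *
      tauto
    · have h1 := fun h' => L.bK f hf (hB f h h')
      simp only [crs, mem_union, mem_inter_iff] at *
      tauto
  rcases S1.eq_empty_or_nonempty with h1 | h1 <;> rcases S2.eq_empty_or_nonempty with h2 | h2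
  · rcases hS e0 (Finset.mem_insert_self _ _) with h | h
    · rw [h1] at h; simp at h
    · rw [h2] at h; simp at h
  · obtain ⟨e, he, U, hU, hxe, hsub⟩ := L.exU S2 hS2 h2
    have hyU : y ∈ U := (hy e he U hU).2 ((hxy e he).1 hxe)
    have hxU : x ∈ U := (hx e he U hU).2 hxe
    have key : ∀ C' : Set W, (C' = C ∨ C' = Cᶜ) → IsClopen C' → v ∈ C' → tight a b P v w e (U ∩ C') := by
      intro C' h' hcl hv
      refine ⟨hU.1.inter hcl, ⟨hU.2.1, hv⟩, fun h => hU.2.2.1 h.1, fun f hf hc => ?_⟩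
      have := cross ∅ U (by simp [h1]) hsub C' h' f hf (by simpa using hc)
      rcases this with h | h
      · simp [crs] at h
      · exact hU.2.2.2 f hf h
    by_cases hv : v ∈ C
    · have := key C (Or.inl rfl) hC hv
      exact hyC ((hy e he _ this).2 ((hxy e he).1 hxe)).2
    · have := key Cᶜ (Or.inr rfl) hC.compl hv
      exact ((hx e he _ this).2 hxe).2 hxC
  · obtain ⟨e, he, A, hA, hxe, hsub⟩ := L.exL S1 hS1 h1
    have key : ∀ C' : Set W, (C' = C ∨ C' = Cᶜ) → IsClopen C' → w ∉ C' → tight a b P v w e (A ∪ C') := by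
      intro C' h' hcl hv
      refine ⟨hA.1.union hcl, Or.inl hA.2.1, by simp [hA.2.2.1, hv], fun f hf hc => ?_⟩
      have := cross A univ hsub (by simp [h2]) C' h' f hf (by simpa using hc)
      rcases this with h | h
      · exact hA.2.2.2 f hf h
      · simp [crs] at h
    by_cases hv : w ∈ C
    · have := key Cᶜ (Or.inr rfl) hC.compl (by simpa using hv)
      exact hxe ((hxy e he).2 ((hy e he _ this).1 (Or.inr hyC)))
    · have := key C (Or.inl rfl) hC hv
      exact hxe ((hx e he _ this).1 (Or.inr hxC))
  · obtain ⟨e, he, U, hU, hxe, hsub⟩ := L.exU S2 hS2 h2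
    obtain ⟨d, hd, A, hA, hxd, hsub'⟩ := L.exL S1 hS1 h1
    have hyU : y ∈ U := (hy e he U hU).2 ((hxy e he).1 hxe)
    have hxU : x ∈ U := (hx e he U hU).2 hxe
    have hyA : y ∉ A := fun h => hxd ((hxy d hd).2 ((hy d hd A hA).1 h))
    have hxA : x ∉ A := fun h => hxd ((hx d hd A hA).1 h)
    have hde : d ≠ e := by rintro rfl; exact hxd hxe
    have base : ∀ C' : Set W, (C' = C ∨ C' = Cᶜ) → ∀ f ∈ P, crs a b (A ∪ (U ∩ C')) f → f = d ∨ f = e := by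
      intro C' h' f hf hc
      rcases cross A U hsub' hsub C' h' f hf hc with h | h
      · exact Or.inl (hA.2.2.2 f hf h)
      · exact Or.inr (hU.2.2.2 f hf h)
    have only : ∀ C' : Set W, (C' = C ∨ C' = Cᶜ) → IsClopen C' → ∀ g g', (∀ f, f = d ∨ f = e → f = g ∨ f = g') →
        ¬ crs a b (A ∪ (U ∩ C')) g' → tight a b P v w g (A ∪ (U ∩ C')) := by
      intro C' h' hcl g g' hgg hn
      refine ⟨hA.1.union (hU.1.inter hcl), Or.inl hA.2.1, ?_, ?_⟩
      · rintro (h | h)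
        · exact hA.2.2.1 h
        · exact hU.2.2.1 h.1
      · intro f hf hc
        rcases hgg f (base C' h' f hf hc) with h | h
        · exact h
        · subst h; exact absurd hc hn
    have e1 : crs a b (A ∪ (U ∩ C)) e := by
      by_contra h
      have := only C (Or.inl rfl) hC d e (by tauto) h
      exact hxd ((hx d hd _ this).1 (Or.inr ⟨hxU, hxC⟩))
    have e2 : crs a b (A ∪ (U ∩ Cᶜ)) e := by
      by_contra h
      have := only Cᶜ (Or.inr rfl) hC.compl d e (by tauto) h
      exact hxd ((hxy d hd).2 ((hy d hd _ this).1 (Or.inr ⟨hyU, hyC⟩)))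
    have h3 := mt (hA.2.2.2 e he) hde.symm
    have h4 := (L.ends he hU).2
    simp only [crs, mem_union, mem_inter_iff, mem_compl_iff] at e1 e2 h3
    tauto

end lin
end


/-- parametrised edges -/
structure ES {X : Type*} [TopologicalSpace X] (V : Set X) (E : Type*) where
  φ : E → unitInterval → X
  cont : ∀ e, Continuous (φ e)
  memV : ∀ e t, φ e t ∈ V ↔ (t = 0 ∨ t = 1)
  inj : ∀ e e' s t, φ e s ∉ V → φ e s = φ e' t → e = e' ∧ s = t
  surj : ∀ x, x ∉ V → ∃ e t, φ e t = x
  openEd : ∀ e, IsOpen (range (φ e) \ V)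

namespace ES
section
open Classical
variable {X : Type*} [TopologicalSpace X] {V : Set X} {E : Type*} (S : ES V E)

def a (e : E) : V := ⟨S.φ e 0, (S.memV e 0).2 (Or.inl rfl)⟩
def b (e : E) : V := ⟨S.φ e 1, (S.memV e 1).2 (Or.inr rfl)⟩
def ed (e : E) : Set X := range (S.φ e) \ V

def hat (C : Set V) : Set X :=
  {x | (∃ h : x ∈ V, (⟨x, h⟩ : V) ∈ C) ∨ ∃ e, S.a e ∈ C ∧ S.b e ∈ C ∧ x ∈ range (S.φ e)}

theorem range_cases (e : E) {x : X} (hx : x ∈ range (S.φ e)) :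
    x ∈ S.ed e ∨ x = S.a e ∨ x = S.b e := by
  by_cases h : x ∈ V
  · obtain ⟨t, rfl⟩ := hx
    rcases (S.memV e t).1 h with rfl | rfl
    · exact Or.inr (Or.inl rfl)
    · exact Or.inr (Or.inr rfl)
  · exact Or.inl ⟨hx, h⟩

theorem mem_ed_unique {e e' : E} {x : X} (hx : x ∈ S.ed e) (hx' : x ∈ range (S.φ e')) : e = e' := by
  obtain ⟨⟨s, rfl⟩, hV⟩ := hx
  obtain ⟨t, ht⟩ := hx'
  exact (S.inj e e' s t hV ht.symm).1

variable [CompactSpace X] [T2Space X]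

theorem split (hV : IsClosed V) {C : Set V} (hC : IsClopen C) :
    ∃ O O' : Set X, IsOpen O ∧ IsOpen O' ∧ Disjoint O O' ∧ (∀ x : V, x ∈ C → x.1 ∈ O) ∧
      (∀ x : V, x ∉ C → x.1 ∈ O') ∧ ∃ F : Finset E, ∀ e ∉ F,
        (range (S.φ e) ⊆ O ∧ S.a e ∈ C ∧ S.b e ∈ C) ∨ (range (S.φ e) ⊆ O' ∧ S.a e ∉ C ∧ S.b e ∉ C) := by
  have h1 : IsClosed (Subtype.val '' C : Set X) := hV.isClosedEmbedding_subtypeVal.isClosedMap _ hC.isClosed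
  have h2 : IsClosed (Subtype.val '' Cᶜ : Set X) := hV.isClosedEmbedding_subtypeVal.isClosedMap _ hC.compl.isClosed
  obtain ⟨O, O', hO, hO', hCO, hCO', hd⟩ := normal_separation h1 h2
    ((disjoint_image_iff Subtype.val_injective).2 disjoint_compl_right)
  have m1 : ∀ x : V, x ∈ C → x.1 ∈ O := fun x hx => hCO ⟨x, hx, rfl⟩
  have m2 : ∀ x : V, x ∉ C → x.1 ∈ O' := fun x hx => hCO' ⟨x, hx, rfl⟩
  refine ⟨O, O', hO, hO', hd, m1, m2, ?_⟩
  have hVO : V ⊆ O ∪ O' := by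
    intro x hx
    by_cases h : (⟨x, hx⟩ : V) ∈ C
    · exact Or.inl (m1 _ h)
    · exact Or.inr (m2 _ h)
  have hcomp : IsCompact (O ∪ O')ᶜ := (hO.union hO').isClosed_compl.isCompact
  obtain ⟨F, hF⟩ := hcomp.elim_finite_subcover (fun e => S.ed e) (fun e => S.openEd e) (by
    intro x hx
    have hxV : x ∉ V := fun h => hx (hVO h)
    obtain ⟨e, t, rfl⟩ := S.surj x hxV
    exact mem_iUnion.2 ⟨e, ⟨t, rfl⟩, hxV⟩)
  refine ⟨F, fun e he => ?_⟩
  have hsub : range (S.φ e) ⊆ O ∪ O' := by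
    intro x hx
    by_contra hno
    obtain ⟨e', he', hxe'⟩ := mem_iUnion₂.1 (hF hno)
    have := S.mem_ed_unique hxe' hx
    exact he (this ▸ he')
  have hpre : IsPreconnected (range (S.φ e)) := isPreconnected_range (S.cont e)
  have nd : ∀ x, x ∈ O → x ∈ O' → False := fun x h h' => disjoint_left.1 hd h h'
  have ma : (S.a e).1 ∈ range (S.φ e) := ⟨0, rfl⟩
  have mb : (S.b e).1 ∈ range (S.φ e) := ⟨1, rfl⟩
  rcases hpre.subset_or_subset hO hO' hd hsub with h | h
  · left
    refine ⟨h, ?_, ?_⟩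
    · by_contra hh; exact nd _ (h ma) (m2 _ hh)
    · by_contra hh; exact nd _ (h mb) (m2 _ hh)
  · right
    refine ⟨h, ?_, ?_⟩
    · intro hh; exact nd _ (m1 _ hh) (h ma)
    · intro hh; exact nd _ (m1 _ hh) (h mb)

theorem fin_crs (hV : IsClosed V) {C : Set V} (hC : IsClopen C) : {e | crs S.a S.b C e}.Finite := by
  obtain ⟨O, O', -, -, -, -, -, F, hF⟩ := S.split hV hC
  refine F.finite_toSet.subset fun e he => ?_
  by_contra h
  rcases hF e h with h | h
  · exact he ⟨fun _ => h.2.2, fun _ => h.2.1⟩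
  · exact he ⟨fun h' => absurd h' h.2.1, fun h' => absurd h' h.2.2⟩

theorem closed_hat (hV : IsClosed V) {C : Set V} (hC : IsClopen C) : IsClosed (S.hat C) := by
  obtain ⟨O, O', hO, hO', hd, m1, m2, F, hF⟩ := S.split hV hC
  have nd : ∀ x, x ∈ O → x ∈ O' → False := fun x h h' => disjoint_left.1 hd h h'
  have heq : S.hat C = (O'ᶜ ∩ (⋃ e ∈ {e | ¬ (S.a e ∈ C ∧ S.b e ∈ C)}, S.ed e)ᶜ) ∪
      ⋃ e ∈ F.filter (fun e => S.a e ∈ C ∧ S.b e ∈ C), range (S.φ e) := by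
    ext x
    constructor
    · rintro (⟨h, hx⟩ | ⟨e, ha, hb, hx⟩)
      · left
        refine ⟨fun h' => nd _ (m1 _ hx) h', ?_⟩
        intro h'
        obtain ⟨e, _, hxe⟩ := mem_iUnion₂.1 h'
        exact hxe.2 h
      · by_cases heF : e ∈ F
        · right
          exact mem_iUnion₂.2 ⟨e, Finset.mem_filter.2 ⟨heF, ha, hb⟩, hx⟩
        · left
          rcases hF e heF with h | h
          · refine ⟨fun h' => nd _ (h.1 hx) h', fun h' => ?_⟩
            obtain ⟨e', he', hxe⟩ := mem_iUnion₂.1 h'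
            have := S.mem_ed_unique hxe hx
            subst this
            exact he' ⟨ha, hb⟩
          · exact absurd ha h.2.1
    · rintro (⟨h1, h2⟩ | h)
      · by_cases hx : x ∈ V
        · left
          refine ⟨hx, ?_⟩
          by_contra h
          exact h1 (m2 _ h)
        · right
          obtain ⟨e, t, rfl⟩ := S.surj x hx
          have : S.a e ∈ C ∧ S.b e ∈ C := by
            by_contra h
            exact h2 (mem_iUnion₂.2 ⟨e, h, ⟨t, rfl⟩, hx⟩)
          exact ⟨e, this.1, this.2, t, rfl⟩
      · obtain ⟨e, he, hx⟩ := mem_iUnion₂.1 h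
        have := (Finset.mem_filter.1 he).2
        exact Or.inr ⟨e, this.1, this.2, hx⟩
  rw [heq]
  refine IsClosed.union (hO'.isClosed_compl.inter ?_) ?_
  · exact (isOpen_biUnion fun e _ => S.openEd e).isClosed_compl
  · exact isClosed_biUnion_finset fun e _ => (isCompact_range (S.cont e)).isClosed

/-- functions on `X` from a clopen cut -/
theorem exists_fun (hV : IsClosed V) {C : Set V} (hC : IsClopen C) (ρ : E → unitInterval → ℝ)
    (hρ : ∀ e, Continuous (ρ e)) (h0 : ∀ e, ρ e 0 = if S.a e ∈ C then 0 else 1)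
    (h1 : ∀ e, ρ e 1 = if S.b e ∈ C then 0 else 1)
    (hn : ∀ e, ¬ crs S.a S.b C e → ∀ t, ρ e t = if S.a e ∈ C then 0 else 1) :
    ∃ g : X → ℝ, Continuous g ∧ (∀ x : V, g x = if x ∈ C then 0 else 1) ∧
      ∀ e t, g (S.φ e t) = ρ e t := by
  choose ie te hte using S.surj
  let g : X → ℝ := fun x => if h : x ∈ V then (if (⟨x, h⟩ : V) ∈ C then 0 else 1) else ρ (ie x h) (te x h)
  have gV : ∀ x : V, g x = if x ∈ C then 0 else 1 := by
    intro x
    simp only [g, dif_pos x.2]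
  have ga : ∀ e, g (S.a e) = ρ e 0 := fun e => by rw [gV, h0]
  have gb : ∀ e, g (S.b e) = ρ e 1 := fun e => by rw [gV, h1]
  have gφ : ∀ e t, g (S.φ e t) = ρ e t := by
    intro e t
    by_cases h : S.φ e t ∈ V
    · rcases (S.memV e t).1 h with rfl | rfl
      · exact ga e
      · exact gb e
    · obtain ⟨r1, r2⟩ := S.inj e _ t _ h (hte _ h).symm
      simp only [g, dif_neg h]
      rw [← r1, ← r2]
  refine ⟨g, ?_, gV, gφ⟩
  rw [continuous_iff_isClosed]
  intro D hD
  have heq : g ⁻¹' D = ({x | (0 : ℝ) ∈ D} ∩ S.hat C) ∪ ({x | (1 : ℝ) ∈ D} ∩ S.hat Cᶜ) ∪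
      ⋃ e ∈ {e | crs S.a S.b C e}, S.φ e '' (ρ e ⁻¹' D) := by
    ext x
    constructor
    · intro hx
      by_cases h : x ∈ V
      · left
        have := gV ⟨x, h⟩
        by_cases hc : (⟨x, h⟩ : V) ∈ C
        · rw [if_pos hc] at this
          exact Or.inl ⟨by rw [mem_preimage, this] at hx; exact hx, Or.inl ⟨h, hc⟩⟩
        · rw [if_neg hc] at this
          exact Or.inr ⟨by rw [mem_preimage, this] at hx; exact hx, Or.inl ⟨h, hc⟩⟩
      · obtain ⟨e, t, rfl⟩ := S.surj x h
        rw [mem_preimage, gφ] at hx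
        by_cases hc : crs S.a S.b C e
        · exact Or.inr (mem_iUnion₂.2 ⟨e, hc, t, hx, rfl⟩)
        · left
          have hh := hn e hc t
          simp only [crs, not_not] at hc
          by_cases ha : S.a e ∈ C
          · rw [if_pos ha] at hh
            exact Or.inl ⟨by rw [hh] at hx; exact hx, Or.inr ⟨e, ha, hc.1 ha, t, rfl⟩⟩
          · rw [if_neg ha] at hh
            exact Or.inr ⟨by rw [hh] at hx; exact hx, Or.inr ⟨e, ha, fun h' => ha (hc.2 h'), t, rfl⟩⟩
    · rintro ((⟨h, hx⟩ | ⟨h, hx⟩) | hx)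
      · rcases hx with ⟨hV', hc⟩ | ⟨e, ha, hb, t, rfl⟩
        · have := gV ⟨x, hV'⟩
          rw [if_pos hc] at this
          rw [mem_preimage, this]; exact h
        · rw [mem_preimage, gφ, hn e (by simp [crs, ha, hb]), if_pos ha]; exact h
      · rcases hx with ⟨hV', hc⟩ | ⟨e, ha, hb, t, rfl⟩
        · have := gV ⟨x, hV'⟩
          rw [if_neg hc] at this
          rw [mem_preimage, this]; exact h
        · rw [mem_compl_iff] at ha hb
          rw [mem_preimage, gφ, hn e (by simp [crs, ha, hb]), if_neg ha]; exact h
      · obtain ⟨e, _, t, ht, rfl⟩ := mem_iUnion₂.1 hx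
        rw [mem_preimage, gφ]; exact ht
  rw [heq]
  refine IsClosed.union (IsClosed.union ?_ ?_) ?_
  · exact isClosed_const.inter (S.closed_hat hV hC)
  · exact isClosed_const.inter (S.closed_hat hV hC.compl)
  · exact (S.fin_crs hV hC).isClosed_biUnion fun e _ =>
      ((hD.preimage (hρ e)).isCompact.image (S.cont e)).isClosed

theorem exists_lin_fun (hV : IsClosed V) {C : Set V} (hC : IsClopen C) :
    ∃ g : X → ℝ, Continuous g ∧ (∀ x : V, g x = if x ∈ C then 0 else 1) ∧
      (∀ x, 0 ≤ g x ∧ g x ≤ 1) ∧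
      ∀ e (t : unitInterval), g (S.φ e t) = (1 - (t : ℝ)) * (if S.a e ∈ C then 0 else 1) + t * (if S.b e ∈ C then 0 else 1) := by
  obtain ⟨g, hg, h1, h2⟩ := S.exists_fun hV hC
    (fun e t => (1 - (t : ℝ)) * (if S.a e ∈ C then 0 else 1) + t * (if S.b e ∈ C then 0 else 1))
    (fun e => by fun_prop) (fun e => by simp) (fun e => by simp) (fun e hn t => by
      simp only [crs, not_not] at hn
      by_cases ha : S.a e ∈ C
      · simp [ha, hn.1 ha]
      · simp [ha, mt hn.2 ha])
  refine ⟨g, hg, h1, ?_, h2⟩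
  intro x
  by_cases hx : x ∈ V
  · have := h1 ⟨x, hx⟩
    simp only at this
    rw [this]; split_ifs <;> norm_num
  · obtain ⟨e, t, rfl⟩ := S.surj x hx
    rw [h2]
    have := t.2.1
    have := t.2.2
    split_ifs <;> constructor <;> linarith

theorem arc_crs (hV : IsClosed V) {C : Set V} (hC : IsClopen C) (f : unitInterval → X) (hf : Continuous f)
    (h0 : ∃ h : f 0 ∈ V, (⟨_, h⟩ : V) ∈ C) (h1 : ∃ h : f 1 ∈ V, (⟨_, h⟩ : V) ∉ C) :
    ∃ e, crs S.a S.b C e ∧ S.ed e ⊆ range f := by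
  by_contra hno
  push Not at hno
  have : ∀ e, ∃ s : unitInterval, s ≠ 0 ∧ s ≠ 1 ∧ (crs S.a S.b C e → S.φ e s ∉ range f) := by
    intro e
    by_cases h : crs S.a S.b C e
    · obtain ⟨x, hx, hxf⟩ := not_subset.1 (hno e h)
      obtain ⟨⟨s, rfl⟩, hxV⟩ := hx
      exact ⟨s, fun h => hxV ((S.memV _ _).2 (Or.inl h)), fun h => hxV ((S.memV _ _).2 (Or.inr h)), fun _ => hxf⟩
    · refine ⟨⟨1/2, by norm_num, by norm_num⟩, ?_, ?_, fun h' => absurd h' h⟩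
      · intro h; have := congrArg Subtype.val h; norm_num at this
      · intro h; have := congrArg Subtype.val h; norm_num at this
  choose s hs0 hs1 hs using this
  have hs0' : ∀ e, 0 < (s e : ℝ) := fun e => unitInterval.pos_iff_ne_zero.2 (hs0 e)
  have hs1' : ∀ e, (s e : ℝ) < 1 := fun e => unitInterval.lt_one_iff_ne_one.2 (hs1 e)
  have hden : ∀ e (t : unitInterval), 0 < (t : ℝ) * (1 - s e) + s e * (1 - t) := by
    intro e t
    have := hs0' e
    have := hs1' e
    rcases eq_or_lt_of_le t.2.1 with h | h
    · rw [← h]; linarith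
    · have := t.2.2
      have : 0 < (t : ℝ) * (1 - s e) := mul_pos h (by linarith)
      have : 0 ≤ (s e : ℝ) * (1 - t) := mul_nonneg (by linarith) (by linarith)
      linarith
  let τ : E → unitInterval → ℝ := fun e t => (t * (1 - s e)) / ((t : ℝ) * (1 - s e) + s e * (1 - t))
  have τc : ∀ e, Continuous (τ e) := fun e => by
    apply Continuous.div (by fun_prop) (by fun_prop) (fun t => (hden e t).ne')
  have τ0 : ∀ e, τ e 0 = 0 := fun e => by simp [τ]
  have τ1 : ∀ e, τ e 1 = 1 := fun e => by
    have : (1 : ℝ) - s e ≠ 0 := by have := hs1' e; linarith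
    simp [τ, this]
  have τh : ∀ e t, τ e t = 1/2 → t = s e := by
    intro e t h
    simp only [τ] at h
    rw [div_eq_iff (hden e t).ne'] at h
    ext
    linarith
  obtain ⟨g, hg, gV, gφ⟩ := S.exists_fun hV hC
    (fun e t => (1 - τ e t) * (if S.a e ∈ C then 0 else 1) + τ e t * (if S.b e ∈ C then 0 else 1))
    (fun e => by have := τc e; fun_prop) (fun e => by simp [τ0]) (fun e => by simp [τ1]) (fun e hn t => by
      simp only [crs, not_not] at hn
      by_cases ha : S.a e ∈ C
      · simp [ha, hn.1 ha]
      · simp [ha, mt hn.2 ha])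
  obtain ⟨m0, c0⟩ := h0
  obtain ⟨m1, c1⟩ := h1
  have g0 : g (f 0) = 0 := by have := gV ⟨_, m0⟩; simpa [c0] using this
  have g1 : g (f 1) = 1 := by have := gV ⟨_, m1⟩; simpa [c1] using this
  have : (1/2 : ℝ) ∈ range (g ∘ f) := by
    apply mem_range_of_exists_le_of_exists_ge (hg.comp hf)
    · exact ⟨0, by simp [g0]⟩
    · exact ⟨1, by simp only [comp, g1]; norm_num⟩
  obtain ⟨r, hr⟩ := this
  simp only [comp] at hr
  by_cases hrV : f r ∈ V
  · have := gV ⟨_, hrV⟩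
    simp only [hr] at this
    split_ifs at this <;> norm_num at this
  · obtain ⟨e, t, ht⟩ := S.surj _ hrV
    rw [← ht, gφ] at hr
    have hcr : crs S.a S.b C e := by
      intro hn
      by_cases ha : S.a e ∈ C
      · simp [ha, hn.1 ha] at hr
      · simp [ha, mt hn.2 ha] at hr
    have : t = s e := by
      apply τh
      by_cases ha : S.a e ∈ C <;> by_cases hb : S.b e ∈ C <;> simp only [crs, ha, hb, if_true, if_false] at hr hcr
      · tauto
      · linarith
      · linarith
      · tauto
    exact hs e hcr ⟨r, by rw [← ht, this]⟩
end
end ES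


namespace ES
section
open Classical
variable {X : Type*} [TopologicalSpace X] {V : Set X} {E : Type*} (S : ES V E)
variable {P : Set E} {v w : V} {K : E → Set V}

def arcSet (S : ES V E) (P : Set E) (v w : V) (K : E → Set V) : Set X :=
  {x | (∃ h : x ∈ V, good S.a S.b P v w K ⟨x, h⟩) ∨ ∃ e ∈ P, x ∈ range (S.φ e)}

structure Coord (S : ES V E) (P : Set E) (K : E → Set V) (G : P → X → ℝ) : Prop where
  cont : ∀ e, Continuous (G e)
  bd : ∀ e x, 0 ≤ G e x ∧ G e x ≤ 1
  vert : ∀ e (x : V), G e x = if x ∈ K e then 0 else 1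
  self : ∀ (e : P) (t : unitInterval), G e (S.φ e t) = t
  nea : ∀ (e d : P), d ≠ e → ∀ t, G e (S.φ d t) = if S.a d ∈ K e then 0 else 1
  neb : ∀ (e d : P), d ≠ e → ∀ t, G e (S.φ d t) = if S.b d ∈ K e then 0 else 1

theorem exists_coord [CompactSpace X] [T2Space X] (hV : IsClosed V)
    (L : Lin S.a S.b P v w K) : ∃ G : P → X → ℝ, Coord S P K G := by
  have : ∀ e : P, ∃ g : X → ℝ, Continuous g ∧ (∀ x : V, g x = if x ∈ K e then 0 else 1) ∧
      (∀ x, 0 ≤ g x ∧ g x ≤ 1) ∧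
      ∀ d (t : unitInterval), g (S.φ d t) = (1 - (t : ℝ)) * (if S.a d ∈ K e then 0 else 1) + t * (if S.b d ∈ K e then 0 else 1) :=
    fun e => S.exists_lin_fun hV (L.tK e e.2).1
  choose G h1 h2 h3 h4 using this
  have ne : ∀ (e d : P), d ≠ e → (S.a d ∈ K e ↔ S.b d ∈ K e) := by
    intro e d hne
    have := mt ((L.tK e e.2).2.2.2 d d.2) (fun h => hne (Subtype.ext h))
    simpa [crs] using this
  refine ⟨G, h1, h3, h2, ?_, ?_, ?_⟩
  · intro e t
    rw [h4, if_pos (L.aK e e.2), if_neg (L.bK e e.2)]; ring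
  · intro e d hne t
    rw [h4]
    have := ne e d hne
    by_cases ha : S.a d ∈ K e
    · simp [ha, this.1 ha]
    · simp [ha, mt this.2 ha]
  · intro e d hne t
    rw [h4]
    have := ne e d hne
    by_cases ha : S.a d ∈ K e
    · simp [ha, this.1 ha]
    · simp [ha, mt this.2 ha]

def ltG (G : P → X → ℝ) (p q : X) : Prop := (∀ f, G f p ≤ G f q) ∧ ∃ f, G f p < G f q

variable {G : P → X → ℝ}

theorem edge_cmp (H : Coord S P K G) (L : Lin S.a S.b P v w K) {p q : X} {e : P} (hp : p ∈ S.ed e)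
    (hq : q ∈ S.arcSet P v w K) (hqe : q ∉ S.ed e) : ltG G p q ∨ ltG G q p := by
  obtain ⟨⟨t, rfl⟩, hpV⟩ := hp
  have ht0 : 0 < (t : ℝ) := unitInterval.pos_iff_ne_zero.2 fun h => hpV ((S.memV _ _).2 (Or.inl h))
  have ht1 : (t : ℝ) < 1 := unitInterval.lt_one_iff_ne_one.2 fun h => hpV ((S.memV _ _).2 (Or.inr h))
  have hz : ∃ z z' : V, good S.a S.b P v w K z ∧ good S.a S.b P v w K z' ∧
      (∀ f, G f z ≤ G f q ∧ G f q ≤ G f z') ∧ G e z = G e q ∧ G e q = G e z' := by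
    rcases hq with ⟨h, hg⟩ | ⟨d, hd, hqd⟩
    · exact ⟨⟨q, h⟩, ⟨q, h⟩, hg, hg, fun f => ⟨le_rfl, le_rfl⟩, rfl, rfl⟩
    · rcases S.range_cases d hqd with h | h | h
      · have hde : d ≠ e := by rintro rfl; exact hqe h
        have hde' : (⟨d, hd⟩ : P) ≠ e := fun h => hde (congrArg Subtype.val h)
        obtain ⟨s, rfl⟩ := hqd
        refine ⟨S.a d, S.b d, L.good_a hd, L.good_b hd, ?_, ?_, ?_⟩
        · intro f
          by_cases hf : (⟨d, hd⟩ : P) = f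
          · subst hf
            rw [H.self ⟨d, hd⟩ s, H.vert, H.vert, if_pos (L.aK d hd), if_neg (L.bK d hd)]
            exact ⟨s.2.1, s.2.2⟩
          · exact ⟨by rw [H.nea f ⟨d, hd⟩ hf s, H.vert], by rw [H.neb f ⟨d, hd⟩ hf s, H.vert]⟩
        · rw [H.nea e ⟨d, hd⟩ hde' s, H.vert]
        · rw [H.neb e ⟨d, hd⟩ hde' s, H.vert]
      · exact ⟨S.a d, S.a d, L.good_a hd, L.good_a hd, by rw [h]; simp, by rw [h], by rw [h]⟩
      · exact ⟨S.b d, S.b d, L.good_b hd, L.good_b hd, by rw [h]; simp, by rw [h], by rw [h]⟩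
  obtain ⟨z, z', hz, hz', hle, h1, h2⟩ := hz
  by_cases hc : z ∈ K e
  · right
    have h3 : G e q = 0 := by rw [← h1, H.vert, if_pos hc]
    have hc' : z' ∈ K e := by
      by_contra h
      rw [H.vert, if_neg h] at h2
      linarith
    refine ⟨fun f => ?_, e, by rw [H.self, h3]; exact ht0⟩
    by_cases hf : e = f
    · subst hf; rw [H.self, h3]; exact ht0.le
    · by_cases hzf : z' ∈ K f
      · have := (hle f).2
        rw [H.vert, if_pos hzf] at this
        exact this.trans (H.bd _ _).1
      · rw [H.nea f e hf, if_neg (L.le_a e.2 f.2 hz' hc' hzf)]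
        exact (H.bd _ _).2
  · left
    have h3 : G e q = 1 := by rw [← h1, H.vert, if_neg hc]
    refine ⟨fun f => ?_, e, by rw [H.self, h3]; exact ht1⟩
    by_cases hf : e = f
    · subst hf; rw [H.self, h3]; exact ht1.le
    · by_cases hbf : S.b e ∈ K f
      · rw [H.neb f e hf, if_pos hbf]
        exact (H.bd _ _).1
      · have := (hle f).1
        rw [H.vert, if_neg (L.b_le e.2 f.2 hz hc hbf)] at this
        exact (H.bd _ _).2.trans this

theorem all_cmp [TotallySeparatedSpace V]
    (hfin : ∀ C : Set V, IsClopen C → {e | crs S.a S.b C e}.Finite) (hvw : v ≠ w)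
    (H : Coord S P K G) (L : Lin S.a S.b P v w K) {p q : X}
    (hp : p ∈ S.arcSet P v w K)
    (hq : q ∈ S.arcSet P v w K) (hpq : p ≠ q) : ltG G p q ∨ ltG G q p := by
  have cases : ∀ x ∈ S.arcSet P v w K, (∃ e : P, x ∈ S.ed e) ∨ ∃ h : x ∈ V, good S.a S.b P v w K ⟨x, h⟩ := by
    rintro x (h | ⟨e, he, hx⟩)
    · exact Or.inr h
    · rcases S.range_cases e hx with h | rfl | rfl
      · exact Or.inl ⟨⟨e, he⟩, h⟩
      · exact Or.inr ⟨(S.a e).2, L.good_a he⟩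
      · exact Or.inr ⟨(S.b e).2, L.good_b he⟩
  rcases cases p hp with ⟨e, he⟩ | ⟨hpV, hpg⟩
  · by_cases hqe : q ∈ S.ed e
    · obtain ⟨⟨t, rfl⟩, -⟩ := he
      obtain ⟨⟨s, rfl⟩, -⟩ := hqe
      have aux : ∀ s t : unitInterval, s < t → ltG G (S.φ e s) (S.φ e t) := by
        intro s t hst
        refine ⟨fun f => ?_, e, by rw [H.self, H.self]; exact hst⟩
        by_cases hf : e = f
        · subst hf; rw [H.self, H.self]; exact hst.le
        · rw [H.nea f e hf, H.nea f e hf]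
      rcases lt_trichotomy s t with h | h | h
      · exact Or.inr (aux _ _ h)
      · exact absurd (by rw [h]) hpq
      · exact Or.inl (aux _ _ h)
    · exact S.edge_cmp H L he hq hqe
  · rcases cases q hq with ⟨e, he⟩ | ⟨hqV, hqg⟩
    · exact (S.edge_cmp H L he hp (fun h => h.2 hpV)).symm
    · obtain ⟨U, hU, hpU, hqU⟩ := exists_isClopen_of_totally_separated
        (show (⟨p, hpV⟩ : V) ≠ ⟨q, hqV⟩ from fun h => hpq (congrArg Subtype.val h))
      have hne : ¬ ∀ e ∈ P, ((⟨p, hpV⟩ : V) ∈ K e ↔ (⟨q, hqV⟩ : V) ∈ K e) :=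
        fun h => L.no_sep hfin hvw hpg hqg h hU hpU hqU
      have aux : ∀ (x y : V), good S.a S.b P v w K x → good S.a S.b P v w K y → ∀ e : P, x ∈ K e → y ∉ K e →
          ltG G x y := by
        intro x y hx hy e hxe hye
        refine ⟨fun f => ?_, e, by rw [H.vert, H.vert, if_pos hxe, if_neg hye]; norm_num⟩
        by_cases hxf : x ∈ K f
        · rw [H.vert, if_pos hxf]; exact (H.bd _ _).1
        · by_cases hyf : y ∈ K f
          · exfalso
            have h1 := L.le_a e.2 f.2 hx hxe hxf
            have hef : f ≠ e := by rintro rfl; exact hxf hxe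
            have h2 := L.le_a f.2 e.2 hy hyf hye
            have h3 := mt ((L.tK f f.2).2.2.2 e e.2) (fun h => hef (Subtype.ext h).symm)
            simp only [crs, not_not] at h3
            exact L.b_le e.2 f.2 hy hye (mt h3.2 h1) hyf
          · rw [H.vert, H.vert, if_neg hxf, if_neg hyf]
      push Not at hne
      obtain ⟨e, he, h | h⟩ := hne
      · exact Or.inl (aux ⟨p, hpV⟩ ⟨q, hqV⟩ hpg hqg ⟨e, he⟩ h.1 h.2)
      · exact Or.inr (aux ⟨q, hqV⟩ ⟨p, hpV⟩ hqg hpg ⟨e, he⟩ h.2 h.1)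

theorem closed_arcSet [CompactSpace X] [T2Space X] (hV : IsClosed V)
    (L : Lin S.a S.b P v w K) : IsClosed (S.arcSet P v w K) := by
  have heq : S.arcSet P v w K = (⋂ e ∈ Pᶜ, (S.ed e)ᶜ) ∩
      ⋂ e ∈ P, ⋂ C ∈ {C | tight S.a S.b P v w e C}, S.hat ((C ∩ K e) ∪ (Cᶜ ∩ (K e)ᶜ)) := by
    have hm : ∀ (C D : Set V) (x : V), x ∈ (C ∩ D) ∪ (Cᶜ ∩ Dᶜ) ↔ (x ∈ C ↔ x ∈ D) := by
      intro C D x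
      simp only [mem_union, mem_inter_iff, mem_compl_iff]; tauto
    ext x
    simp only [mem_inter_iff, mem_iInter, mem_compl_iff, mem_ofPred_eq]
    constructor
    · rintro (⟨h, hg⟩ | ⟨d, hd, hx⟩)
      · exact ⟨fun e _ he => he.2 h, fun e he C hC => Or.inl ⟨h, (hm _ _ _).2 (hg e he C hC)⟩⟩
      · refine ⟨fun e heP he => heP ?_, fun e he C hC => Or.inr ⟨d, ?_, ?_, hx⟩⟩
        · rw [S.mem_ed_unique he hx]; exact hd
        · exact (hm _ _ _).2 (L.good_a hd e he C hC)
        · exact (hm _ _ _).2 (L.good_b hd e he C hC)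
    · rintro ⟨h1, h2⟩
      by_cases hx : x ∈ V
      · left
        refine ⟨hx, fun e he C hC => ?_⟩
        rw [← hm]
        rcases h2 e he C hC with ⟨_, h⟩ | ⟨d, ha, hb, h⟩
        · exact h
        · rcases S.range_cases d h with h | h | h
          · exact absurd hx h.2
          · convert ha
          · convert hb
      · right
        obtain ⟨e, t, rfl⟩ := S.surj x hx
        refine ⟨e, ?_, t, rfl⟩
        by_contra he
        exact h1 e he ⟨⟨t, rfl⟩, hx⟩
  rw [heq]
  refine IsClosed.inter (isClosed_biInter fun e _ => (S.openEd e).isClosed_compl) ?_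
  refine isClosed_biInter fun e he => isClosed_biInter fun C hC => S.closed_hat hV ?_
  exact (hC.1.inter (L.tK e he).1).union (hC.1.compl.inter (L.tK e he).1.compl)

theorem exists_height [CompactSpace X] [T2Space X] [Countable E] (hP : P.Nonempty)
    (L : Lin S.a S.b P v w K) (H : Coord S P K G) :
    ∃ g : X → ℝ, Continuous g ∧ g v = 0 ∧ g w = 1 ∧ (∀ x, 0 ≤ g x ∧ g x ≤ 1) ∧
      ∀ p q, ltG G p q → g p < g q := by
  have := Encodable.ofCountable P
  obtain ⟨ε, hε, c, hc, -⟩ := posSumOfEncodable (zero_lt_one : (0 : ℝ) < 1) P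
  obtain ⟨e0, he0⟩ := hP
  have hcpos : 0 < c := (hε ⟨e0, he0⟩).trans_le (le_hasSum hc _ fun i _ => (hε i).le)
  have hs : HasSum (fun i => ε i / c) 1 := by
    have := hc.div_const c
    rwa [div_self hcpos.ne'] at this
  have hpos : ∀ i, 0 < ε i / c := fun i => div_pos (hε i) hcpos
  have hle : ∀ i x, ε i / c * G i x ≤ ε i / c := fun i x =>
    mul_le_of_le_one_right (hpos i).le (H.bd i x).2
  have hge : ∀ i x, 0 ≤ ε i / c * G i x := fun i x => mul_nonneg (hpos i).le (H.bd i x).1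
  have hsum : ∀ x, Summable fun i => ε i / c * G i x := fun x =>
    Summable.of_nonneg_of_le (fun i => hge i x) (fun i => hle i x) hs.summable
  refine ⟨fun x => ∑' i, ε i / c * G i x, ?_, ?_, ?_, ?_, ?_⟩
  · refine continuous_tsum (fun i => continuous_const.mul (H.cont i)) hs.summable ?_
    intro i x
    rw [Real.norm_of_nonneg (hge i x)]
    exact hle i x
  · have : ∀ i, G i v = 0 := fun i => by rw [H.vert, if_pos (L.tK i i.2).2.1]
    simp [this]
  · have : ∀ i, G i w = 1 := fun i => by rw [H.vert, if_neg (L.tK i i.2).2.2.1]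
    simp only [this, mul_one]
    exact hs.tsum_eq
  · intro x
    refine ⟨tsum_nonneg fun i => hge i x, ?_⟩
    rw [← hs.tsum_eq]
    exact (hsum x).tsum_le_tsum (fun i => hle i x) hs.summable
  · rintro p q ⟨h1, f, hf⟩
    exact Summable.tsum_lt_tsum (i := f) (fun i => mul_le_mul_of_nonneg_left (h1 i) (hpos i).le)
      (mul_lt_mul_of_pos_left hf (hpos f)) (hsum p) (hsum q)

theorem arc_exists [CompactSpace X] [T2Space X] [Countable E] [TotallyDisconnectedSpace V]
    (hV : IsClosed V) (hvw : v ≠ w) (L : Lin S.a S.b P v w K) :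
    ∃ f : unitInterval → X, Continuous f ∧ Injective f ∧ f 0 = v ∧ f 1 = w ∧
      ∀ e, S.ed e ⊆ range f → e ∈ P := by
  have : CompactSpace V := isCompact_iff_compactSpace.1 hV.isCompact
  have : TotallySeparatedSpace V := inferInstance
  obtain ⟨e0, he0⟩ : P.Nonempty := by
    obtain ⟨U, hU, h1, h2⟩ := exists_isClopen_of_totally_separated hvw
    obtain ⟨e, he, _⟩ := L.hit U hU h1 h2
    exact ⟨e, he⟩
  obtain ⟨G, H⟩ := S.exists_coord hV L
  obtain ⟨g, gc, gv, gw, gbd, glt⟩ := S.exists_height ⟨e0, he0⟩ L H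
  have hYc := S.closed_arcSet hV L
  have : CompactSpace (S.arcSet P v w K) := isCompact_iff_compactSpace.1 hYc.isCompact
  have hvY : v.1 ∈ S.arcSet P v w K := Or.inl ⟨v.2, L.good_v⟩
  have hwY : w.1 ∈ S.arcSet P v w K := Or.inl ⟨w.2, L.good_w⟩
  let γ : S.arcSet P v w K → unitInterval := fun x => ⟨g x, gbd x⟩
  have γc : Continuous γ := by fun_prop
  have γi : Injective γ := by
    rintro ⟨p, hp⟩ ⟨q, hq⟩ hpq
    have hg : g p = g q := congrArg Subtype.val hpq
    by_contra hne
    rcases S.all_cmp (fun C hC => S.fin_crs hV hC) hvw H L hp hq (fun h => hne (Subtype.ext h)) with h | h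
    · have := glt _ _ h; linarith
    · have := glt _ _ h; linarith
  have gns : ∀ r : ℝ, 0 ≤ r → r ≤ 1 → ∃ x ∈ S.arcSet P v w K, g x = r := by
    intro r hr0 hr1
    by_contra hno
    push Not at hno
    have hr0' : 0 < r := lt_of_le_of_ne hr0 (fun h => hno _ hvY (by rw [gv, h]))
    have hr1' : r < 1 := lt_of_le_of_ne hr1 (fun h => hno _ hwY (by rw [gw, h]))
    let Z : Set V := {x | x.1 ∈ S.arcSet P v w K}
    have hZ : IsClosed Z := hYc.preimage continuous_subtype_val
    have hM1 : IsClosed (Z ∩ {x : V | g x ≤ r}) :=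
      hZ.inter (isClosed_le (by fun_prop) continuous_const)
    have hM2 : IsClosed (Z ∩ {x : V | r ≤ g x}) :=
      hZ.inter (isClosed_le continuous_const (by fun_prop))
    obtain ⟨C, hC, hC1, hC2⟩ := exists_clopen_of_closed_subset_open hM1 hM2.isOpen_compl (by
      rintro x ⟨hx, hxr⟩ ⟨_, hxr'⟩
      exact hno _ hx (le_antisymm hxr hxr'))
    obtain ⟨e, he, hcr⟩ := L.hit C hC (hC1 ⟨hvY, by simp only [mem_ofPred_eq, gv]; exact hr0⟩)
      (fun h => hC2 h ⟨hwY, by simp only [mem_ofPred_eq, gw]; exact hr1⟩)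
    have haZ : S.a e ∈ Z := Or.inl ⟨(S.a e).2, L.good_a he⟩
    have hbZ : S.b e ∈ Z := Or.inl ⟨(S.b e).2, L.good_b he⟩
    have c1 : ∀ x ∈ Z, x ∈ C → g x ≤ r := by
      intro x hx hxC
      by_contra h
      exact hC2 hxC ⟨hx, (not_le.1 h).le⟩
    have c2 : ∀ x ∈ Z, x ∉ C → r ≤ g x := by
      intro x hx hxC
      by_contra h
      exact hxC (hC1 ⟨hx, (not_le.1 h).le⟩)
    have : r ∈ range (g ∘ S.φ e) := by
      by_cases ha : S.a e ∈ C
      · have hb : S.b e ∉ C := fun hb => hcr (by tauto)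
        exact mem_range_of_exists_le_of_exists_ge (gc.comp (S.cont e)) ⟨0, c1 _ haZ ha⟩ ⟨1, c2 _ hbZ hb⟩
      · have hb : S.b e ∈ C := by by_contra hb; exact hcr (by tauto)
        exact mem_range_of_exists_le_of_exists_ge (gc.comp (S.cont e)) ⟨1, c1 _ hbZ hb⟩ ⟨0, c2 _ haZ ha⟩
    obtain ⟨t, ht⟩ := this
    exact hno (S.φ e t) (Or.inr ⟨e, he, t, rfl⟩) ht
  have γs : Surjective γ := by
    intro r
    obtain ⟨x, hx, h⟩ := gns r r.2.1 r.2.2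
    exact ⟨⟨x, hx⟩, Subtype.ext h⟩
  let Φ := Continuous.homeoOfEquivCompactToT2 (f := Equiv.ofBijective γ ⟨γi, γs⟩) γc
  have hΦ : ∀ x, Φ x = γ x := fun x => rfl
  refine ⟨fun t => (Φ.symm t).1, by fun_prop, fun s t h => Φ.symm.injective (Subtype.ext h), ?_, ?_, ?_⟩
  · have : Φ ⟨v, hvY⟩ = 0 := by rw [hΦ]; exact Subtype.ext gv
    simp only [← this, Homeomorph.symm_apply_apply]
  · have : Φ ⟨w, hwY⟩ = 1 := by rw [hΦ]; exact Subtype.ext gw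
    simp only [← this, Homeomorph.symm_apply_apply]
  · intro e he
    have hh : (⟨1/2, by norm_num, by norm_num⟩ : unitInterval) ≠ 0 ∧ (⟨1/2, by norm_num, by norm_num⟩ : unitInterval) ≠ 1 := by
      constructor <;> (intro h; have := congrArg Subtype.val h; norm_num at this)
    have hm : S.φ e ⟨1/2, by norm_num, by norm_num⟩ ∈ S.ed e :=
      ⟨⟨_, rfl⟩, fun h => ((S.memV _ _).1 h).elim hh.1 hh.2⟩
    obtain ⟨t, ht⟩ := he hm
    simp only at ht
    rcases (Φ.symm t).2 with ⟨h, _⟩ | ⟨d, hd, h⟩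
    · rw [ht] at h; exact absurd h hm.2
    · rw [ht] at h; rw [S.mem_ed_unique hm h]; exact hd
end
end ES


namespace ES
section
open Classical
variable {X : Type*} [TopologicalSpace X] {V : Set X} {E : Type*} (S : ES V E)

theorem flip_exists (F : E → Prop) : ∃ S' : ES V E, (∀ e, S'.ed e = S.ed e) ∧
    (∀ e, F e → S'.a e = S.b e ∧ S'.b e = S.a e) ∧ (∀ e, ¬ F e → S'.a e = S.a e ∧ S'.b e = S.b e) := by
  let σ : E → unitInterval → unitInterval := fun e t => if F e then unitInterval.symm t else t
  have σ1 : ∀ e t, F e → σ e t = unitInterval.symm t := fun e t h => if_pos h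
  have σ2 : ∀ e t, ¬ F e → σ e t = t := fun e t h => if_neg h
  have σσ : ∀ e t, σ e (σ e t) = t := by
    intro e t
    by_cases h : F e
    · rw [σ1 _ _ h, σ1 _ _ h, unitInterval.symm_symm]
    · rw [σ2 _ _ h, σ2 _ _ h]
  have σc : ∀ e, Continuous (σ e) := by
    intro e
    by_cases h : F e
    · have : σ e = unitInterval.symm := funext fun t => σ1 e t h
      rw [this]; exact unitInterval.continuous_symm
    · have : σ e = id := funext fun t => σ2 e t h
      rw [this]; exact continuous_id
  have hr : ∀ e, range (fun t => S.φ e (σ e t)) = range (S.φ e) := by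
    intro e
    ext x
    constructor
    · rintro ⟨t, rfl⟩; exact ⟨_, rfl⟩
    · rintro ⟨t, rfl⟩; exact ⟨σ e t, by simp only [σσ]⟩
  let S' : ES V E :=
    { φ := fun e t => S.φ e (σ e t)
      cont := fun e => (S.cont e).comp (σc e)
      memV := by
        intro e t
        rw [S.memV]
        by_cases h : F e
        · rw [σ1 _ _ h, unitInterval.symm_eq_zero, unitInterval.symm_eq_one, or_comm]
        · rw [σ2 _ _ h]
      inj := by
        intro e e' s t h h'
        obtain ⟨rfl, h2⟩ := S.inj e e' _ _ h h'
        exact ⟨rfl, by rw [← σσ e s, h2, σσ]⟩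
      surj := by
        intro x hx
        obtain ⟨e, t, h⟩ := S.surj x hx
        exact ⟨e, σ e t, by rw [σσ, h]⟩
      openEd := by
        intro e
        rw [hr]; exact S.openEd e }
  refine ⟨S', fun e => ?_, fun e h => ?_, fun e h => ?_⟩
  · change range (fun t => S.φ e (σ e t)) \ V = _
    rw [hr]; rfl
  · constructor <;> apply Subtype.ext
    · change S.φ e (σ e 0) = S.φ e 1
      rw [σ1 _ _ h, unitInterval.symm_zero]
    · change S.φ e (σ e 1) = S.φ e 0
      rw [σ1 _ _ h, unitInterval.symm_one]
  · constructor <;> apply Subtype.ext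
    · change S.φ e (σ e 0) = S.φ e 0
      rw [σ2 _ _ h]
    · change S.φ e (σ e 1) = S.φ e 1
      rw [σ2 _ _ h]

theorem arc_of_hit [CompactSpace X] [T2Space X] [Countable E] [TotallyDisconnectedSpace V]
    (hV : IsClosed V) {v w : V} (hvw : v ≠ w) (P : Set E)
    (hP : ∀ C : Set V, IsClopen C → v ∈ C → w ∉ C → ∃ e ∈ P, crs S.a S.b C e) :
    ∃ f : unitInterval → X, Continuous f ∧ Injective f ∧ f 0 = v ∧ f 1 = w ∧
      ∀ e, S.ed e ⊆ range f → e ∈ P := by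
  have : CompactSpace V := isCompact_iff_compactSpace.1 hV.isCompact
  obtain ⟨Q, hQP, hQ, ht⟩ := exists_minimal S.a S.b (fun C hC => S.fin_crs hV hC) v w P hP
  choose! K hK using ht
  obtain ⟨S', h1, h2, h3⟩ := S.flip_exists (fun e => S.a e ∉ K e)
  have hcr : ∀ C e, crs S'.a S'.b C e ↔ crs S.a S.b C e := by
    intro C e
    by_cases h : S.a e ∉ K e
    · simp only [crs, (h2 e h).1, (h2 e h).2]; tauto
    · simp only [crs, (h3 e h).1, (h3 e h).2]
  have hK2 : ∀ e ∈ Q, crs S.a S.b (K e) e := by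
    intro e he
    obtain ⟨d, hd, hc⟩ := hQ (K e) (hK e he).1 (hK e he).2.1 (hK e he).2.2.1
    have := (hK e he).2.2.2 d hd hc
    exact this ▸ hc
  have L : Lin S'.a S'.b Q v w K := by
    refine ⟨?_, ?_, ?_, ?_⟩
    · simp only [hcr]; exact hQ
    · intro e he
      simp only [tight, hcr]
      exact hK e he
    · intro e he
      have := hK2 e he
      by_cases h : S.a e ∉ K e
      · rw [(h2 e h).1]; simp only [crs] at this; tauto
      · rw [(h3 e h).1]; tauto
    · intro e he
      have := hK2 e he
      by_cases h : S.a e ∉ K e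
      · rw [(h2 e h).2]; exact h
      · rw [(h3 e h).2]; simp only [crs] at this; tauto
  obtain ⟨f, f1, f2, f3, f4, f5⟩ := S'.arc_exists hV hvw L
  exact ⟨f, f1, f2, f3, f4, fun e he => hQP (f5 e (by rw [h1]; exact he))⟩

theorem half_mem (e : E) : S.φ e ⟨1/2, by norm_num, by norm_num⟩ ∈ S.ed e := by
  have hh : (⟨1/2, by norm_num, by norm_num⟩ : unitInterval) ≠ 0 ∧ (⟨1/2, by norm_num, by norm_num⟩ : unitInterval) ≠ 1 := by
    constructor <;> (intro h; have := congrArg Subtype.val h; norm_num at this)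
  exact ⟨⟨_, rfl⟩, fun h => ((S.memV _ _).1 h).elim hh.1 hh.2⟩

theorem countable_E (S : ES V E) [TopologicalSpace.SeparableSpace X] : Countable E := by
  have h := Set.PairwiseDisjoint.countable_of_isOpen (s := S.ed) (a := univ) (by
    intro e _ e' _ hne
    exact disjoint_left.2 fun x hx hx' => hne (S.mem_ed_unique hx hx'.1)) (fun e _ => S.openEd e)
    (fun e _ => ⟨_, S.half_mem e⟩)
  exact countable_univ_iff.1 h

theorem ed_eq (e : E) : S.ed e = S.φ e '' Ioo 0 1 := by
  ext x
  constructor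
  · rintro ⟨⟨t, rfl⟩, h⟩
    rw [S.memV] at h
    push Not at h
    exact ⟨t, ⟨unitInterval.pos_iff_ne_zero.2 h.1, unitInterval.lt_one_iff_ne_one.2 h.2⟩, rfl⟩
  · rintro ⟨t, ht, rfl⟩
    refine ⟨⟨t, rfl⟩, ?_⟩
    rw [S.memV]
    push Not
    exact ⟨ht.1.ne', ht.2.ne⟩

theorem comp_eq (e : E) {x : X} (hx : x ∈ S.ed e) : connectedComponentIn Vᶜ x = S.ed e := by
  apply subset_antisymm
  · refine IsPreconnected.subset_left_of_subset_union (S.openEd e)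
      (isOpen_biUnion (s := {e}ᶜ) fun d _ => S.openEd d) ?_ ?_ ?_ isPreconnected_connectedComponentIn
    · rw [disjoint_left]
      intro y hy hy'
      obtain ⟨d, hd, hyd⟩ := mem_iUnion₂.1 hy'
      exact hd (S.mem_ed_unique hyd hy.1)
    · intro y hy
      have hyV := connectedComponentIn_subset _ _ hy
      obtain ⟨d, t, rfl⟩ := S.surj y hyV
      by_cases hd : d = e
      · subst hd; exact Or.inl ⟨⟨t, rfl⟩, hyV⟩
      · exact Or.inr (mem_iUnion₂.2 ⟨d, hd, ⟨t, rfl⟩, hyV⟩)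
    · exact ⟨x, mem_connectedComponentIn hx.2, hx⟩
  · refine IsPreconnected.subset_connectedComponentIn ?_ hx (fun y hy => hy.2)
    rw [ed_eq]
    exact isPreconnected_Ioo.image _ (S.cont e).continuousOn

theorem closure_ed [T2Space X] (e : E) : closure (S.ed e) = range (S.φ e) := by
  apply subset_antisymm
  · exact closure_minimal sdiff_subset (isCompact_range (S.cont e)).isClosed
  · rw [ed_eq, ← image_univ]
    refine subset_trans (image_mono ?_) (image_closure_subset_closure_image (S.cont e))
    rw [closure_Ioo zero_ne_one]
    intro t _
    exact ⟨unitInterval.nonneg', unitInterval.le_one'⟩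

theorem ed_injective : Injective S.ed := by
  intro e e' h
  have := S.half_mem e
  have h2 := this
  rw [h] at h2
  exact S.mem_ed_unique this h2.1

/-- combinatorial core -/
theorem core [CompactSpace X] [T2Space X] [Countable E] [TotallyDisconnectedSpace V]
    (hV : IsClosed V) (v : V) (A : Set V) (hA : IsClopen A) (hvA : v ∈ A) :
    ∃ C0 : Set V, IsClopen C0 ∧ v ∈ C0 ∧ C0 ⊆ A ∧
      ∃ f : Fin {e | crs S.a S.b C0 e}.ncard → unitInterval → X,
        (∀ i, Continuous (f i) ∧ Injective (f i) ∧ f i 0 = v ∧ ∃ w : V, w ∉ A ∧ f i 1 = w) ∧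
        ∀ i j, ∀ e, S.ed e ⊆ range (f i) → S.ed e ⊆ range (f j) → i = j := by
  have : CompactSpace V := isCompact_iff_compactSpace.1 hV.isCompact
  have hex : ∃ m, ∃ C : Set V, IsClopen C ∧ v ∈ C ∧ C ⊆ A ∧ {e | crs S.a S.b C e}.ncard = m :=
    ⟨_, A, hA, hvA, subset_rfl, rfl⟩
  obtain ⟨C0, h1, h2, h3, h4⟩ := Nat.find_spec hex
  have hmin : ∀ C : Set V, IsClopen C → v ∈ C → C ⊆ A →
      {e | crs S.a S.b C0 e}.ncard ≤ {e | crs S.a S.b C e}.ncard := by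
    intro C hC hv hCA
    rw [h4]
    exact Nat.find_min' hex ⟨C, hC, hv, hCA, rfl⟩
  refine ⟨C0, h1, h2, h3, ?_⟩
  obtain ⟨c, hc⟩ := coloring S.a S.b (fun C hC => S.fin_crs hV hC) v A _ hmin
  have : ∀ i : Fin {e | crs S.a S.b C0 e}.ncard, ∃ f : unitInterval → X,
      (Continuous f ∧ Injective f ∧ f 0 = v ∧ ∃ w : V, w ∉ A ∧ f 1 = w) ∧
        ∀ e, S.ed e ⊆ range f → c e = i := by
    intro i
    obtain ⟨w, hw, hh⟩ := target S.a S.b v A hA {e | c e = i} (fun C hC hv hCA => by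
      obtain ⟨e, he, hce⟩ := hc C hC hv hCA i i.2
      exact ⟨e, hce, he⟩)
    obtain ⟨f, f1, f2, f3, f4, f5⟩ := S.arc_of_hit hV (show v ≠ w from fun h => hw (h ▸ hvA)) {e | c e = i} hh
    exact ⟨f, ⟨f1, f2, f3, w, hw, f4⟩, f5⟩
  choose f hf hf' using this
  exact ⟨f, hf, fun i j e hi hj => Fin.ext ((hf' i e hi).symm.trans (hf' j e hj))⟩


theorem lim_exists [CompactSpace X] [T2Space X] [TotallyDisconnectedSpace V] (hV : IsClosed V)
    (l : Filter ℝ) [l.NeBot] (f : ℝ → X) (hb : ∀ Q : Set X, IsCompact Q → Q ⊆ Vᶜ → ∀ᶠ t in l, f t ∉ Q)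
    (hc : ∀ U ∈ l, ∃ s ∈ l, s ⊆ U ∧ IsPreconnected (f '' s)) :
    ∃ x ∈ V, Tendsto f l (𝓝 x) := by
  have : CompactSpace V := isCompact_iff_compactSpace.1 hV.isCompact
  have hcl : ∀ x, ClusterPt x (map f l) → x ∈ V := by
    intro x hx
    by_contra hxV
    obtain ⟨Q, hQ, hxQ, hQV⟩ := exists_compact_subset hV.isOpen_compl hxV
    have h1 := hb Q hQ hQV
    have h2 : Qᶜ ∈ map f l := h1
    have := clusterPt_iff_nonempty.1 hx (mem_interior_iff_mem_nhds.1 hxQ) h2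
    simp at this
  obtain ⟨x, -, hx⟩ := isCompact_univ (X := X) (f := map f l) (by simp)
  refine ⟨x, hcl x hx, ?_⟩
  refine isCompact_univ.le_nhds_of_unique_clusterPt (by simp) ?_
  intro y _ hy
  by_contra hne
  obtain ⟨C, hC, hxC, hyC⟩ := exists_isClopen_of_totally_separated
    (show (⟨x, hcl x hx⟩ : V) ≠ ⟨y, hcl y hy⟩ from fun h => hne (congrArg Subtype.val h).symm)
  have h1 : IsClosed (Subtype.val '' C : Set X) := hV.isClosedEmbedding_subtypeVal.isClosedMap _ hC.isClosed
  have h2 : IsClosed (Subtype.val '' Cᶜ : Set X) := hV.isClosedEmbedding_subtypeVal.isClosedMap _ hC.compl.isClosed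
  obtain ⟨O, O', hO, hO', hCO, hCO', hd⟩ := normal_separation h1 h2
    ((disjoint_image_iff Subtype.val_injective).2 disjoint_compl_right)
  have m1 : x ∈ O := hCO ⟨_, hxC, rfl⟩
  have m2 : y ∈ O' := hCO' ⟨_, hyC, rfl⟩
  have hVO : V ⊆ O ∪ O' := by
    intro x hx
    by_cases h : (⟨x, hx⟩ : V) ∈ C
    · exact Or.inl (hCO ⟨_, h, rfl⟩)
    · exact Or.inr (hCO' ⟨_, h, rfl⟩)
  have hQ := hb (O ∪ O')ᶜ (hO.union hO').isClosed_compl.isCompact (compl_subset_compl.2 hVO)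
  obtain ⟨s, hs, hsU, hpre⟩ := hc _ hQ
  have hs' : f '' s ∈ map f l := image_mem_map hs
  have hsub : f '' s ⊆ O ∪ O' := by
    rintro _ ⟨t, ht, rfl⟩
    have := hsU ht
    exact not_not.1 this
  obtain ⟨p, hp, hp'⟩ := clusterPt_iff_nonempty.1 hx (hO.mem_nhds m1) hs'
  obtain ⟨q, hq, hq'⟩ := clusterPt_iff_nonempty.1 hy (hO'.mem_nhds m2) hs'
  rcases hpre.subset_or_subset hO hO' hd hsub with h | h
  · exact disjoint_left.1 hd (h hq') hq
  · exact disjoint_left.1 hd hp (h hp')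

theorem build [CompactSpace X] [T2Space X] [TotallyDisconnectedSpace V] (hV : IsClosed V)
    [TopologicalSpace E] [DiscreteTopology E] (h : (Vᶜ : Set X) ≃ₜ (E × ↥(Set.Ioo (0 : ℝ) 1))) :
    Nonempty (ES V E) := by
  let hf : (0 : ℝ) < 1/2 ∧ (1/2 : ℝ) < 1 := by norm_num
  let f : E → ℝ → X := fun e t => if ht : t ∈ Ioo (0 : ℝ) 1 then (h.symm (e, ⟨t, ht⟩)).1 else (h.symm (e, ⟨1/2, hf⟩)).1
  have fI : ∀ e (t : Ioo (0 : ℝ) 1), f e t = (h.symm (e, t)).1 := fun e t => dif_pos t.2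
  have fc : ∀ e, ContinuousOn (f e) (Ioo 0 1) := by
    intro e
    rw [continuousOn_iff_continuous_domRestrict]
    have : (Ioo 0 1).domRestrict (f e) = fun t => (h.symm (e, t)).1 := funext fun t => fI e t
    rw [this]
    fun_prop
  have key : ∀ e (x : ℝ), x ∈ Icc (0 : ℝ) 1 → x ∉ Ioo (0 : ℝ) 1 → ∃ y ∈ V, Tendsto (f e) (𝓝[Ioo 0 1] x) (𝓝 y) := by
    intro e x hx hx'
    have hxc : x ∈ closure (Ioo (0 : ℝ) 1) := by rw [closure_Ioo zero_ne_one]; exact hx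
    have : (𝓝[Ioo (0 : ℝ) 1] x).NeBot := mem_closure_iff_nhdsWithin_neBot.1 hxc
    apply lim_exists hV
    · intro Q hQ hQV
      have hQ' : IsCompact (Subtype.val ⁻¹' Q : Set (Vᶜ : Set X)) := by
        rw [Topology.IsInducing.subtypeVal.isCompact_iff, Subtype.image_preimage_coe, inter_eq_right.2 hQV]
        exact hQ
      have hT : IsCompact ((fun y => ((h y).2 : ℝ)) '' (Subtype.val ⁻¹' Q : Set (Vᶜ : Set X))) :=
        hQ'.image (by fun_prop)
      have hxT : x ∉ ((fun y => ((h y).2 : ℝ)) '' (Subtype.val ⁻¹' Q : Set (Vᶜ : Set X))) := by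
        rintro ⟨y, _, rfl⟩
        exact hx' (h y).2.2
      have h1 := mem_nhdsWithin_of_mem_nhds (t := Ioo 0 1) (hT.isClosed.isOpen_compl.mem_nhds hxT)
      filter_upwards [h1, self_mem_nhdsWithin] with t ht ht' hQt
      refine ht ⟨h.symm (e, ⟨t, ht'⟩), ?_, by simp⟩
      rw [mem_preimage, ← fI e ⟨t, ht'⟩]
      exact hQt
    · intro U hU
      obtain ⟨δ, hδ, hU⟩ := Metric.mem_nhdsWithin_iff.1 hU
      refine ⟨_, Metric.mem_nhdsWithin_iff.2 ⟨δ, hδ, subset_rfl⟩, hU, ?_⟩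
      exact ((convex_ball x δ).inter (convex_Ioo 0 1)).isPreconnected.image _ ((fc e).mono inter_subset_right)
  have hlim : ∀ e, ∀ x ∈ Icc (0 : ℝ) 1, ∃ y, Tendsto (f e) (𝓝[Ioo 0 1] x) (𝓝 y) := by
    intro e x hx
    by_cases hx' : x ∈ Ioo (0 : ℝ) 1
    · exact ⟨_, fc e x hx'⟩
    · obtain ⟨y, _, h⟩ := key e x hx hx'
      exact ⟨y, h⟩
  have hcl : Icc (0 : ℝ) 1 ⊆ closure (Ioo 0 1) := by rw [closure_Ioo zero_ne_one]
  have gc : ∀ e, ContinuousOn (extendFrom (Ioo 0 1) (f e)) (Icc 0 1) := fun e =>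
    continuousOn_extendFrom hcl (hlim e)
  let φ : E → unitInterval → X := fun e t => extendFrom (Ioo 0 1) (f e) t
  have φI : ∀ e (t : unitInterval) (ht : (t : ℝ) ∈ Ioo (0 : ℝ) 1), φ e t = (h.symm (e, ⟨t, ht⟩)).1 := by
    intro e t ht
    rw [← fI e ⟨t, ht⟩]
    exact extendFrom_eq (hcl t.2) (fc e t ht)
  have φV : ∀ e (t : unitInterval), (t : ℝ) ∉ Ioo (0 : ℝ) 1 → φ e t ∈ V := by
    intro e t ht
    obtain ⟨y, hy, hh⟩ := key e t t.2 ht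
    have : φ e t = y := extendFrom_eq (hcl t.2) hh
    rw [this]; exact hy
  have hmem : ∀ e t, φ e t ∈ V ↔ (t : ℝ) ∉ Ioo (0 : ℝ) 1 := by
    intro e t
    refine ⟨fun hh ht => ?_, φV e t⟩
    rw [φI e t ht] at hh
    exact (h.symm (e, ⟨t, ht⟩)).2 hh
  have hs : ∀ x, ∀ hx : x ∉ V, φ (h ⟨x, hx⟩).1 ⟨(h ⟨x, hx⟩).2, Ioo_subset_Icc_self (h ⟨x, hx⟩).2.2⟩ = x := by
    intro x hx
    rw [φI _ _ (h ⟨x, hx⟩).2.2]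
    simp
  refine ⟨⟨φ, fun e => continuousOn_iff_continuous_domRestrict.1 (gc e), ?_, ?_, ?_, ?_⟩⟩
  · intro e t
    rw [hmem]
    have h1 := t.2.1
    have h2 := t.2.2
    constructor
    · intro hh
      by_contra hno
      push Not at hno
      exact hh ⟨unitInterval.pos_iff_ne_zero.2 hno.1, unitInterval.lt_one_iff_ne_one.2 hno.2⟩
    · rintro (rfl | rfl) <;> simp
  · intro e e' s t h1 h2
    have h3 := h1
    rw [h2] at h3
    rw [hmem, not_not] at h1 h3
    rw [φI _ _ h1, φI _ _ h3] at h2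
    have := h.symm.injective (Subtype.ext h2)
    simp only [Prod.mk.injEq, Subtype.mk.injEq] at this
    exact ⟨this.1, Subtype.ext this.2⟩
  · intro x hx
    exact ⟨_, _, hs x hx⟩
  · intro e
    have : range (φ e) \ V = Subtype.val '' ((fun y => (h y).1) ⁻¹' {e} : Set (Vᶜ : Set X)) := by
      ext x
      constructor
      · rintro ⟨⟨t, rfl⟩, hx⟩
        have ht := hx
        rw [hmem, not_not] at ht
        refine ⟨⟨_, hx⟩, ?_, rfl⟩
        simp [φI e t ht]
      · rintro ⟨⟨y, hy⟩, hye, rfl⟩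
        have := hs y hy
        simp only [mem_preimage, mem_singleton_iff] at hye
        rw [hye] at this
        exact ⟨⟨_, this⟩, hy⟩
    rw [this]
    exact hV.isOpen_compl.isOpenEmbedding_subtypeVal.isOpenMap _ ((isOpen_discrete {e}).preimage (by fun_prop))

end
end ES

theorem cut_eq [T2Space X] (G : GraphLike X) (S : ES G.V G.E) (C : Set G.V) :
    G.cut (Subtype.val '' C) (G.V \ Subtype.val '' C) = S.ed '' {e | crs S.a S.b C e} := by
  have hm : ∀ x : G.V, x.1 ∈ (Subtype.val '' C : Set X) ↔ x ∈ C := fun x =>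
    Subtype.val_injective.mem_set_image
  ext s
  constructor
  · rintro ⟨⟨x, hx, rfl⟩, h1, h2⟩
    obtain ⟨e, t, rfl⟩ := S.surj x hx
    rw [S.comp_eq e ⟨⟨t, rfl⟩, hx⟩] at h1 h2 ⊢
    refine ⟨e, ?_, rfl⟩
    rw [S.closure_ed] at h1 h2
    obtain ⟨y, hy, ⟨y', hyC, rfl⟩⟩ := h1
    obtain ⟨z, hz, hzV, hzC⟩ := h2
    intro hiff
    have hzC' : (⟨z, hzV⟩ : G.V) ∉ C := fun h => hzC ⟨_, h, rfl⟩
    have h3 : y' = S.a e ∨ y' = S.b e := by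
      rcases S.range_cases e hy with h | h | h
      · exact absurd y'.2 h.2
      · exact Or.inl (Subtype.ext h)
      · exact Or.inr (Subtype.ext h)
    have h4 : (⟨z, hzV⟩ : G.V) = S.a e ∨ (⟨z, hzV⟩ : G.V) = S.b e := by
      rcases S.range_cases e hz with h | h | h
      · exact absurd hzV h.2
      · exact Or.inl (Subtype.ext h)
      · exact Or.inr (Subtype.ext h)
    rcases h3 with h3 | h3 <;> rcases h4 with h4 | h4 <;> rw [h3] at hyC <;> rw [h4] at hzC' <;> tauto
  · rintro ⟨e, he, rfl⟩
    have hh := S.half_mem e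
    refine ⟨⟨_, hh.2, (S.comp_eq e hh).symm⟩, ?_⟩
    rw [S.closure_ed]
    have ha : (S.a e).1 ∈ range (S.φ e) := ⟨0, rfl⟩
    have hb : (S.b e).1 ∈ range (S.φ e) := ⟨1, rfl⟩
    by_cases hc : S.a e ∈ C
    · have hd : S.b e ∉ C := fun hd => he (by tauto)
      exact ⟨⟨_, ha, (hm _).2 hc⟩, ⟨_, hb, (S.b e).2, fun h => hd ((hm _).1 h)⟩⟩
    · have hd : S.b e ∈ C := by by_contra hd; exact he (by tauto)
      exact ⟨⟨_, hb, (hm _).2 hd⟩, ⟨_, ha, (S.a e).2, fun h => hc ((hm _).1 h)⟩⟩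

theorem main_aux [CompactSpace X] [TopologicalSpace.MetrizableSpace X]
    (G : GraphLike X) {v : X} (hv : v ∈ G.V) (A : Set X) (hA : G.ClopenIn A) (hvA : v ∈ A) :
    ∃ C, G.ClopenIn C ∧ v ∈ C ∧ C ⊆ A ∧
      IsGreatest (G.arcConn {v} (G.V \ A)) (G.cut C (G.V \ C)).ncard := by
  have hV := G.closedV
  have := G.zeroDimV
  obtain ⟨S⟩ : Nonempty (ES G.V G.E) := by
    letI : TopologicalSpace G.E := ⊥
    haveI : DiscreteTopology G.E := ⟨rfl⟩
    obtain ⟨h⟩ := G.homeo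
    exact ES.build hV h
  have : TopologicalSpace.SeparableSpace X := by
    letI := TopologicalSpace.metrizableSpaceMetric X
    infer_instance
  have : Countable G.E := S.countable_E
  have hA' : IsClopen (Subtype.val ⁻¹' A : Set G.V) := by
    refine ⟨hA.2.1.preimage continuous_subtype_val, ?_⟩
    rw [← isClosed_compl_iff]
    have : (Subtype.val ⁻¹' A : Set G.V)ᶜ = Subtype.val ⁻¹' (G.V \ A) := by
      ext x; simp
    rw [this]
    exact hA.2.2.preimage continuous_subtype_val
  obtain ⟨C, hC, hvC, hCA, f, hf, hfd⟩ := S.core hV ⟨v, hv⟩ _ hA' hvA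
  have hcard : (G.cut (Subtype.val '' C) (G.V \ Subtype.val '' C)).ncard = {e | crs S.a S.b C e}.ncard := by
    rw [cut_eq G S C, ncard_image_of_injective _ S.ed_injective]
  have hcl : ∀ D : Set G.V, IsClopen D → IsClosed (Subtype.val '' D : Set X) := fun D hD =>
    hV.isClosedEmbedding_subtypeVal.isClosedMap _ hD.isClosed
  refine ⟨Subtype.val '' C, ⟨?_, hcl C hC, ?_⟩, ⟨_, hvC, rfl⟩, ?_, ?_⟩
  · rintro _ ⟨x, _, rfl⟩; exact x.2
  · have : G.V \ Subtype.val '' C = Subtype.val '' Cᶜ := by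
      ext x
      simp
    rw [this]
    exact hcl _ hC.compl
  · rintro _ ⟨x, hx, rfl⟩; exact hCA hx
  rw [hcard]
  constructor
  · refine ⟨f, fun i => ?_, ?_⟩
    · obtain ⟨h1, h2, h3, w, hw, h4⟩ := hf i
      exact ⟨h1, h2, h3, by rw [h4]; exact ⟨w.2, hw⟩⟩
    · rintro i j hij _ ⟨x, hx, rfl⟩ ⟨h1, h2⟩
      obtain ⟨e, t, rfl⟩ := S.surj x hx
      rw [S.comp_eq e ⟨⟨t, rfl⟩, hx⟩] at h1 h2
      exact hij (hfd i j e h1 h2)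
  · rintro n ⟨g, hg, hgd⟩
    have : ∀ i, ∃ e, crs S.a S.b C e ∧ S.ed e ⊆ range (g i) := by
      intro i
      obtain ⟨h1, h2, h3, h4⟩ := hg i
      rw [mem_singleton_iff] at h3
      refine S.arc_crs hV hC (g i) h1 ⟨by rw [h3]; exact hv, ?_⟩ ⟨h4.1, fun h => h4.2 (hCA h)⟩
      convert hvC
    choose e he hed using this
    have hfin := S.fin_crs hV hC
    have : Finite {e | crs S.a S.b C e} := hfin
    have hinj : Injective (fun i : Fin n => (⟨e i, he i⟩ : {e | crs S.a S.b C e})) := by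
      intro i j hij
      have hij : e i = e j := congrArg Subtype.val hij
      by_contra hne
      have hh := S.half_mem (e i)
      refine hgd i j hne (S.ed (e i)) ⟨_, hh.2, (S.comp_eq _ hh).symm⟩ ⟨hed i, ?_⟩
      rw [hij]; exact hed j
    have := Nat.card_le_card_of_injective _ hinj
    rw [Nat.card_fin, Nat.card_coe_set_eq] at this
    exact this

/-- In a graph-like continuum, even vertices have strongly even degree
and odd vertices have strongly odd degree. -/
theorem even_imp_stronglyEven_and_odd_imp_stronglyOdd
    [CompactSpace X] [TopologicalSpace.MetrizableSpace X] [ConnectedSpace X]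
    (G : GraphLike X) {v : X} (hv : v ∈ G.V) :
    (G.EvenVertex v → G.StronglyEvenDegree v) ∧
    (G.OddVertex v → G.StronglyOddDegree v) := by
  constructor
  · rintro ⟨A0, h1, h2, h3⟩
    refine ⟨A0, h1, h2, fun A hA hvA hAA => ?_⟩
    obtain ⟨C, hC, hvC, hCA, hm⟩ := main_aux G hv A hA hvA
    exact ⟨_, hm, (h3 C hC hvC (hCA.trans hAA)).2⟩
  · rintro ⟨A0, h1, h2, h3⟩
    refine ⟨A0, h1, h2, fun A hA hvA hAA => ?_⟩
    obtain ⟨C, hC, hvC, hCA, hm⟩ := main_aux G hv A hA hvA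
    exact ⟨_, hm, (h3 C hC hvC (hCA.trans hAA)).2⟩
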